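/- There exist constants c_A ≥ 1, N_0 and C, depending only on ξ, A, B, such that the following holds. Let f satisfy condition (f) and assume ‖f‖ ≥ N^{-1/4}/√2. Then for any M ≥ 0, any N ≥ N_0 and any δ > 0: P( x ∈ [A,B] : |Σ_{n=M+1}^{M+N} f(ξ x^{s_n})| ≥ δ c_A ‖f‖^{1/4} √(N log log N) ) ≤ C ( exp((1−δ/2) ‖f‖^{-1/2} log log N) + δ^{-2} N^{-16} ). -/

import Mathlib

open MeasureTheory Filter

/-- The `L²` norm of `f` over `[A,B]`. -/
noncomputable def fnorm (A B : ℝ) (f : ℝ → ℝ) : ℝ :=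
  Real.sqrt (∫ x in A..B, (f x) ^ 2)

/-- The natural logarithm, interpreted as `max {1, log x}`. -/
noncomputable def plog (x : ℝ) : ℝ := max 1 (Real.log x)

lemma v_deriv {ξ : ℝ} (hξ : 0 < ξ) {n : ℕ} (hn : 1 ≤ n) {x : ℝ} (hx : 0 < x) :
    HasDerivAt (fun x : ℝ => (ξ * (n * x ^ (n - 1)))⁻¹)
      (-(((n - 1 : ℕ) : ℝ) / x * (ξ * (n * x ^ (n - 1)))⁻¹)) x := by
  obtain ⟨m, rfl⟩ : ∃ m, n = m + 1 := ⟨n - 1, by omega⟩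
  have h1 : HasDerivAt (fun x : ℝ => ξ * (((m + 1 : ℕ) : ℝ) * x ^ (m + 1 - 1)))
      (ξ * (((m + 1 : ℕ) : ℝ) * ((m : ℝ) * x ^ (m - 1)))) x := by
    simpa using ((hasDerivAt_pow m x).const_mul ((m + 1 : ℕ) : ℝ)).const_mul ξ
  have h2 := h1.inv (by positivity)
  refine HasDerivAt.congr_deriv h2 ?_
  rcases m with _ | m
  · simp
  · simp only [Nat.add_sub_cancel]
    push_cast
    field_simp
    ring

lemma ph_deriv {ξ : ℝ} {n : ℕ} (x : ℝ) :
    HasDerivAt (fun x : ℝ => ξ * x ^ n) (ξ * (n * x ^ (n - 1))) x :=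
  (hasDerivAt_pow n x).const_mul ξ

lemma v_bound {ξ : ℝ} (hξ : 0 < ξ) {n : ℕ} (hn : 1 ≤ n) {x : ℝ} (hx : 0 < x) :
    ((n - 1 : ℕ) : ℝ) / x * (ξ * (n * x ^ (n - 1)))⁻¹ ≤ (ξ * x ^ n)⁻¹ := by
  obtain ⟨m, rfl⟩ : ∃ m, n = m + 1 := ⟨n - 1, by omega⟩
  simp only [Nat.add_sub_cancel]
  push_cast
  have : (ξ * x ^ (m + 1))⁻¹ = ((m:ℝ) + 1) / x * (ξ * (((m:ℝ)+1) * x ^ m))⁻¹ := by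
    field_simp
    ring
  rw [this]
  gcongr
  linarith

lemma ibp {ξ A B : ℝ} (hξ : 0 < ξ) (hA : 1 < A) (hAB : A ≤ B) {n : ℕ} (hn : 1 ≤ n)
    {g g' W w : ℝ → ℝ} {Ω : ℝ} {S : Set ℝ} (hS : S.Countable)
    (hg : ∀ x, HasDerivAt g (g' x) x) (hg'c : Continuous g') (hg0 : ∀ x, 0 ≤ g x)
    (hW : Continuous W) (hWd : ∀ y, y ∉ S → HasDerivAt W (w y) y) (hΩ : ∀ y, |W y| ≤ Ω)
    (hint : IntervalIntegrable (fun x => w (ξ * x ^ n)) volume A B) :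
    |∫ x in A..B, g x * w (ξ * x ^ n)| ≤
      Ω * (g A * (ξ * (n * A ^ (n - 1)))⁻¹ + g B * (ξ * (n * B ^ (n - 1)))⁻¹
        + ∫ x in A..B, (|g' x| * (ξ * (n * x ^ (n - 1)))⁻¹ + g x * (ξ * x ^ n)⁻¹)) := by
  have hgc : Continuous g := continuous_iff_continuousAt.2 fun x => (hg x).continuousAt
  set v : ℝ → ℝ := fun x => (ξ * (n * x ^ (n - 1)))⁻¹ with hv
  have hpos : ∀ x ∈ Set.Icc A B, 0 < x := fun x hx => by linarith [hx.1]
  have hu : Set.uIcc A B = Set.Icc A B := Set.uIcc_of_le hAB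
  have hn' : (0:ℝ) < n := by exact_mod_cast hn
  have hvc : ContinuousOn v (Set.Icc A B) := fun x hx =>
    (v_deriv hξ hn (hpos x hx)).continuousAt.continuousWithinAt
  have hv0 : ∀ x ∈ Set.Icc A B, 0 ≤ v x := fun x hx => by
    have := hpos x hx
    simp only [hv]; positivity
  have hinvc : ContinuousOn (fun x : ℝ => (ξ * x ^ n)⁻¹) (Set.Icc A B) := by
    apply ContinuousOn.inv₀ (by fun_prop)
    intro x hx
    have := hpos x hx
    positivity
  have hWpc : Continuous (fun x : ℝ => W (ξ * x ^ n)) := by fun_prop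
  set R : ℝ → ℝ := fun x => g' x * W (ξ * x ^ n) * v x
      - g x * W (ξ * x ^ n) * (((n - 1 : ℕ) : ℝ) / x * v x) with hR
  have hRc : ContinuousOn R (Set.Icc A B) := by
    apply ContinuousOn.sub
    · exact (by fun_prop : Continuous fun x => g' x * W (ξ * x ^ n)).continuousOn.mul hvc
    · apply ((by fun_prop : Continuous fun x => g x * W (ξ * x ^ n)).continuousOn).mul
      apply ContinuousOn.mul _ hvc
      apply ContinuousOn.div continuousOn_const continuousOn_id
      intro x hx; exact (hpos x hx).ne'
  have hRi : IntervalIntegrable R volume A B := by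
    apply ContinuousOn.intervalIntegrable; rwa [hu]
  have hgi : IntervalIntegrable (fun x => g x * w (ξ * x ^ n)) volume A B :=
    hint.continuousOn_mul hgc.continuousOn
  have hinj : Set.InjOn (fun x : ℝ => ξ * x ^ n) (Set.Icc A B) := by
    intro x hx y hy hxy
    have h1 : x ^ n = y ^ n := mul_left_cancel₀ hξ.ne' hxy
    exact (pow_left_inj₀ (hpos x hx).le (hpos y hy).le (by omega)).1 h1
  have hcount : (Set.Icc A B ∩ (fun x : ℝ => ξ * x ^ n) ⁻¹' S).Countable := by
    apply Set.MapsTo.countable_of_injOn (f := fun x : ℝ => ξ * x ^ n) (t := S)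
    · intro x hx; exact hx.2
    · exact hinj.mono Set.inter_subset_left
    · exact hS
  have hFTC := integral_eq_of_hasDerivAt_off_countable_of_le
    (fun x => g x * W (ξ * x ^ n) * v x) (fun x => g x * w (ξ * x ^ n) + R x) hAB hcount
    ((by fun_prop : Continuous fun x => g x * W (ξ * x ^ n)).continuousOn.mul hvc)
    (by
      intro x hx
      have hxI : x ∈ Set.Icc A B := Set.Ioo_subset_Icc_self hx.1
      have hxS : ξ * x ^ n ∉ S := fun h => hx.2 ⟨hxI, h⟩
      have hx0 := hpos x hxI
      have h1 := (hWd _ hxS).comp x (ph_deriv (ξ := ξ) (n := n) x)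
      have h2 := ((hg x).mul h1).mul (v_deriv hξ hn hx0)
      refine HasDerivAt.congr_deriv h2 ?_
      simp only [hR, hv, Function.comp, Pi.mul_apply]
      have : (ξ * (n * x ^ (n - 1))) * (ξ * (n * x ^ (n - 1)))⁻¹ = 1 := by
        apply mul_inv_cancel₀; positivity
      rw [show g x * (w (ξ * x ^ n) * (ξ * (n * x ^ (n - 1)))) = (g x * w (ξ * x ^ n)) * (ξ * (n * x ^ (n - 1))) by ring, add_mul, mul_assoc (g x * w (ξ * x ^ n)), this]; ring)
    (hgi.add hRi)
  rw [intervalIntegral.integral_add hgi hRi] at hFTC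
  have hΩ0 : 0 ≤ Ω := (abs_nonneg _).trans (hΩ 0)
  have hKc : ContinuousOn (fun x => |g' x| * v x + g x * (ξ * x ^ n)⁻¹) (Set.Icc A B) :=
    ((by fun_prop : Continuous fun x => |g' x|).continuousOn.mul hvc).add
      (hgc.continuousOn.mul hinvc)
  have hRb : |∫ x in A..B, R x| ≤ Ω * ∫ x in A..B, (|g' x| * v x + g x * (ξ * x ^ n)⁻¹) := by
    rw [← intervalIntegral.integral_const_mul]
    rw [← Real.norm_eq_abs]
    apply intervalIntegral.norm_integral_le_of_norm_le hAB
    · refine Eventually.of_forall fun x hx => ?_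
      have hxI : x ∈ Set.Icc A B := Set.Ioc_subset_Icc_self hx
      have hx0 := hpos x hxI
      have h3 : 0 ≤ ((n - 1 : ℕ) : ℝ) / x * v x := mul_nonneg (by positivity) (hv0 x hxI)
      have h4 : ((n - 1 : ℕ) : ℝ) / x * v x ≤ (ξ * x ^ n)⁻¹ := v_bound hξ hn hx0
      rw [Real.norm_eq_abs]
      calc |R x| ≤ |g' x * W (ξ * x ^ n) * v x| +
            |g x * W (ξ * x ^ n) * (((n - 1 : ℕ) : ℝ) / x * v x)| := abs_sub _ _
        _ = |W (ξ * x ^ n)| * (|g' x| * v x + g x * (((n - 1 : ℕ) : ℝ) / x * v x)) := by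
            rw [abs_mul, abs_mul, abs_mul, abs_mul, abs_of_nonneg (hv0 x hxI), abs_of_nonneg h3,
              abs_of_nonneg (hg0 x)]; ring
        _ ≤ Ω * (|g' x| * v x + g x * (ξ * x ^ n)⁻¹) := by
            have := hv0 x hxI
            have := hg0 x
            gcongr
            exact hΩ _
    · apply IntervalIntegrable.const_mul
      apply ContinuousOn.intervalIntegrable; rwa [hu]
  have hA1 : |g A * W (ξ * A ^ n) * v A| ≤ Ω * (g A * v A) := by
    have := hv0 A ⟨le_rfl, hAB⟩
    rw [abs_mul, abs_mul, abs_of_nonneg this, abs_of_nonneg (hg0 A)]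
    have := mul_le_mul_of_nonneg_right (hΩ (ξ * A ^ n)) (mul_nonneg (hg0 A) this)
    linarith
  have hB1 : |g B * W (ξ * B ^ n) * v B| ≤ Ω * (g B * v B) := by
    have := hv0 B ⟨hAB, le_rfl⟩
    rw [abs_mul, abs_mul, abs_of_nonneg this, abs_of_nonneg (hg0 B)]
    have := mul_le_mul_of_nonneg_right (hΩ (ξ * B ^ n)) (mul_nonneg (hg0 B) this)
    linarith
  have : ∫ x in A..B, g x * w (ξ * x ^ n) = g B * W (ξ * B ^ n) * v B - g A * W (ξ * A ^ n) * v A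
      - ∫ x in A..B, R x := by linarith
  rw [this]
  rw [abs_le] at *
  constructor <;> linarith [hA1.1, hA1.2, hB1.1, hB1.2, hRb.1, hRb.2]

lemma ratio {ξ A x : ℝ} (hξ : 0 < ξ) (hA : 1 < A) (hx : A ≤ x) {k n : ℕ} (hk : k ≤ n) (hn : 1 ≤ n) :
    ξ * (k * x ^ (k - 1)) * (ξ * (n * x ^ (n - 1)))⁻¹ ≤ (A⁻¹) ^ (n - k) := by
  have hx0 : 0 < x := by linarith
  have hn' : (0:ℝ) < n := by exact_mod_cast hn
  rcases Nat.eq_zero_or_pos k with rfl | hk0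
  · simp; positivity
  obtain ⟨d, rfl⟩ : ∃ d, n = k + d := ⟨n - k, by omega⟩
  have h1 : k + d - 1 = (k - 1) + d := by omega
  rw [h1, Nat.add_sub_cancel_left, inv_pow, ← div_eq_mul_inv, div_le_iff₀ (by positivity),
    inv_mul_eq_div, le_div_iff₀ (by positivity), pow_add]
  have h2 : A ^ d ≤ x ^ d := by gcongr
  have h3 : (k:ℝ) ≤ ((k + d : ℕ) : ℝ) := by push_cast; linarith [Nat.cast_nonneg (α := ℝ) d]
  calc ξ * (k * x ^ (k - 1)) * A ^ d ≤ ξ * (((k + d : ℕ) : ℝ) * x ^ (k - 1)) * x ^ d := by gcongr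
    _ = _ := by ring

lemma ratio_inv {ξ A x : ℝ} (hξ : 0 < ξ) (hA : 1 < A) (hx : A ≤ x) {k n : ℕ} (hk : k ≤ n) (hk1 : 1 ≤ k) :
    (ξ * (n * x ^ (n - 1)))⁻¹ ≤ (A⁻¹) ^ (n - k) * (ξ * (k * x ^ (k - 1)))⁻¹ := by
  have h := ratio hξ hA hx hk (hk1.trans hk)
  have hx0 : 0 < x := by linarith
  have hk' : (0:ℝ) < k := by exact_mod_cast hk1
  rw [← div_eq_mul_inv, le_div_iff₀ (by positivity)]
  linarith

lemma delta_low {ξ A B : ℝ} (hξ : 0 < ξ) (hA : 1 < A) (hAB : B - A = 1) {n : ℕ} (hn : 1 ≤ n) :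
    ξ ≤ ξ * B ^ n - ξ * A ^ n := by
  obtain ⟨m, rfl⟩ : ∃ m, n = m + 1 := ⟨n - 1, by omega⟩
  have h1 : A ^ m ≤ B ^ m := by gcongr; linarith
  have h2 : (1:ℝ) ≤ A ^ m := one_le_pow₀ hA.le
  have : 1 ≤ B ^ (m+1) - A ^ (m+1) := by
    have hB : B = A + 1 := by linarith
    have : B ^ (m+1) - A ^ (m+1) = (B ^ m - A ^ m) * A + B ^ m := by rw [hB]; ring
    rw [this]; nlinarith
  nlinarith

lemma bdry {ξ A B : ℝ} (hξ : 0 < ξ) (hA : 1 < A) (hAB : B - A = 1) {n : ℕ} (hn : 1 ≤ n)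
    {g g' : ℝ → ℝ} {κ : ℝ}
    (hg : ∀ x, HasDerivAt g (g' x) x) (hg0 : ∀ x, 0 ≤ g x)
    (hκ : ∀ x ∈ Set.Icc A B, |g' x| ≤ κ * g x * (ξ * (n * x ^ (n - 1)))) :
    g A * (ξ * (n * A ^ (n - 1)))⁻¹ ≤ (κ + 2 / ξ) * ∫ x in A..B, g x ∧
    g B * (ξ * (n * B ^ (n - 1)))⁻¹ ≤ (κ + 2 / ξ) * ∫ x in A..B, g x := by
  have hgc : Continuous g := continuous_iff_continuousAt.2 fun x => (hg x).continuousAt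
  have hAB' : A ≤ B := by linarith
  have hn' : (0:ℝ) < n := by exact_mod_cast hn
  have hpos : ∀ x ∈ Set.Icc A B, 0 < x := fun x hx => by linarith [hx.1]
  set v : ℝ → ℝ := fun x => (ξ * (n * x ^ (n - 1)))⁻¹ with hv
  have hv0 : ∀ x ∈ Set.Icc A B, 0 < v x := fun x hx => by
    have := hpos x hx
    simp only [hv]; positivity
  have hvc : ContinuousOn v (Set.Icc A B) := fun x hx =>
    (v_deriv hξ hn (hpos x hx)).continuousAt.continuousWithinAt
  set Δ := ξ * B ^ n - ξ * A ^ n with hΔ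
  have hΔξ : ξ ≤ Δ := delta_low hξ hA hAB hn
  have hΔ0 : 0 < Δ := by linarith
  have hg'v : ∀ x ∈ Set.Icc A B, |g' x| * v x ≤ κ * g x := by
    intro x hx
    have := hv0 x hx
    have h1 := mul_le_mul_of_nonneg_right (hκ x hx) this.le
    have h2 : (ξ * (n * x ^ (n - 1))) * v x = 1 := by
      have := hpos x hx
      simp only [hv]; apply mul_inv_cancel₀; positivity
    calc _ ≤ _ := h1
      _ = κ * g x * ((ξ * (n * x ^ (n - 1))) * v x) := by ring
      _ = _ := by rw [h2]; ring
  have hsec : ∀ x ∈ Set.Icc A B, ((n - 1 : ℕ) : ℝ) / x * v x ≤ 1 / ξ := by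
    intro x hx
    refine (v_bound hξ hn (hpos x hx)).trans ?_
    rw [one_div]
    apply inv_anti₀ hξ
    have : 1 ≤ x ^ n := one_le_pow₀ (by linarith [hx.1])
    nlinarith
  have key : ∀ (l : ℝ → ℝ) (c : ℝ), |c| = 1 →
      (∀ x, HasDerivAt l (c * (ξ * (n * x ^ (n - 1))) / Δ) x) →
      (∀ x ∈ Set.Icc A B, 0 ≤ l x ∧ l x ≤ 1) → c * (g B * l B * v B - g A * l A * v A) ≤
        (κ + 2 / ξ) * ∫ x in A..B, g x := by
    intro l c hc hl hl01
    have hlc : Continuous l := continuous_iff_continuousAt.2 fun x => (hl x).continuousAt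
    rw [← intervalIntegral.integral_const_mul]
    have := intervalIntegral.sub_le_integral_of_hasDeriv_right_of_le
      (g := fun x => c * (g x * l x * v x))
      (g' := fun x => c * ((g' x * l x + g x * (c * (ξ * (n * x ^ (n - 1))) / Δ)) * v x +
        g x * l x * (-(((n - 1 : ℕ) : ℝ) / x * v x)))) (φ := fun x => (κ + 2 / ξ) * g x) hAB'
      (continuousOn_const.mul ((hgc.mul hlc).continuousOn.mul hvc))
      (by
        intro x hx
        have hxI := Set.Ioo_subset_Icc_self hx
        exact ((((hg x).mul (hl x)).mul (v_deriv hξ hn (hpos x hxI))).const_mul c).hasDerivWithinAt)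
      ((by fun_prop : Continuous fun x => (κ + 2 / ξ) * g x).continuousOn.integrableOn_Icc)
      (by
        intro x hx
        have hxI := Set.Ioo_subset_Icc_self hx
        have h1 := hg'v x hxI
        have h2 := hsec x hxI
        obtain ⟨h3, h4⟩ := hl01 x hxI
        have h5 : (ξ * (n * x ^ (n - 1))) * v x = 1 := by
          have := hpos x hxI
          simp only [hv]; apply mul_inv_cancel₀; positivity
        have hv' := hv0 x hxI
        have h6 : 0 ≤ ((n - 1 : ℕ) : ℝ) / x * v x := by
          have := hpos x hxI
          positivity
        have e1 : c * (g' x * l x * v x) ≤ κ * g x := by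
          calc c * (g' x * l x * v x) ≤ |c * (g' x * l x * v x)| := le_abs_self _
            _ = l x * (|g' x| * v x) := by
              rw [abs_mul, hc, abs_mul, abs_mul, abs_of_nonneg h3, abs_of_pos hv']; ring
            _ ≤ 1 * (|g' x| * v x) := by gcongr
            _ ≤ _ := by linarith
        have hc2 : c * c = 1 := by
          rw [← abs_mul_abs_self, hc]; ring
        have e2 : c * (g x * (c * (ξ * (n * x ^ (n - 1))) / Δ) * v x) ≤ 1 / ξ * g x := by
          calc _ = (c * c) * ((ξ * (n * x ^ (n - 1))) * v x) * (1 / Δ) * g x := by ring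
            _ = 1 / Δ * g x := by rw [hc2, h5]; ring
            _ ≤ _ := by
              have := hg0 x
              gcongr
        have e3 : c * (g x * l x * (-(((n - 1 : ℕ) : ℝ) / x * v x))) ≤ 1 / ξ * g x := by
          calc _ ≤ |c * (g x * l x * (-(((n - 1 : ℕ) : ℝ) / x * v x)))| := le_abs_self _
            _ = l x * (g x * (((n - 1 : ℕ) : ℝ) / x * v x)) := by
              rw [abs_mul, hc, abs_mul, abs_mul, abs_neg, abs_of_nonneg h3, abs_of_nonneg h6,
                abs_of_nonneg (hg0 x)]; ring
            _ ≤ 1 * (g x * (1 / ξ)) := by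
              have := hg0 x
              gcongr
            _ = _ := by ring
        have : (κ + 2 / ξ) * g x = κ * g x + 1 / ξ * g x + 1 / ξ * g x := by ring
        rw [this]
        linarith)
    linarith
  have hmono : ∀ x ∈ Set.Icc A B, ξ * A ^ n ≤ ξ * x ^ n ∧ ξ * x ^ n ≤ ξ * B ^ n := by
    intro x hx
    have := hpos x hx
    have h1 := hx.1
    have h2 := hx.2
    constructor <;> gcongr
  constructor
  · have := key (fun x => (ξ * B ^ n - ξ * x ^ n) / Δ) (-1) (by simp)
      (fun x => (((ph_deriv (ξ := ξ) (n := n) x).const_sub (ξ * B ^ n)).div_const Δ).congr_deriv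
        (by ring))
      (fun x hx => by
        obtain ⟨h1, h2⟩ := hmono x hx
        constructor
        · apply div_nonneg _ hΔ0.le; linarith
        · rw [div_le_one hΔ0]; linarith)
    simp only [sub_self, zero_div, ← hΔ, div_self hΔ0.ne'] at this
    simp only [hv] at this
    linarith
  · have := key (fun x => (ξ * x ^ n - ξ * A ^ n) / Δ) (1) (by simp)
      (fun x => (((ph_deriv (ξ := ξ) (n := n) x).sub_const (ξ * A ^ n)).div_const Δ).congr_deriv
        (by ring))
      (fun x hx => by
        obtain ⟨h1, h2⟩ := hmono x hx
        constructor
        · apply div_nonneg _ hΔ0.le; linarith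
        · rw [div_le_one hΔ0]; linarith)
    simp only [sub_self, zero_div, ← hΔ, div_self hΔ0.ne'] at this
    simp only [hv] at this
    linarith

lemma pw {w : ℝ → ℝ} (hp : ∀ x, w (x + 1) = w x) (hi : ∀ a b, IntervalIntegrable w volume a b)
    (h0 : ∫ x in (0:ℝ)..1, w x = 0) {Ω : ℝ} (hΩ : ∫ x in (0:ℝ)..1, |w x| ≤ Ω) (y : ℝ) :
    |∫ x in (0:ℝ)..y, w x| ≤ Ω := by
  have hper : Function.Periodic w 1 := hp
  have hWp : Function.Periodic (fun y => ∫ x in (0:ℝ)..y, w x) 1 := by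
    intro y
    have h1 := hper.intervalIntegral_add_eq y 0
    rw [zero_add, h0] at h1
    show (∫ x in (0:ℝ)..(y+1), w x) = ∫ x in (0:ℝ)..y, w x
    rw [← intervalIntegral.integral_add_adjacent_intervals (hi 0 y) (hi y (y+1)), h1, add_zero]
  have h2 : (∫ x in (0:ℝ)..y, w x) = ∫ x in (0:ℝ)..(Int.fract y), w x := by
    have := hWp.sub_int_mul_eq ⌊y⌋ (x := y)
    simp only [mul_one] at this
    exact this.symm
  rw [h2]
  have hf0 := Int.fract_nonneg y
  have hf1 := (Int.fract_lt_one y).le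
  calc |∫ x in (0:ℝ)..(Int.fract y), w x| ≤ ∫ x in (0:ℝ)..(Int.fract y), |w x| :=
        intervalIntegral.abs_integral_le_integral_abs hf0
    _ ≤ ∫ x in (0:ℝ)..1, |w x| := by
        apply intervalIntegral.integral_mono_interval le_rfl hf0 hf1
        · exact Eventually.of_forall fun x => abs_nonneg _
        · exact (hi 0 1).abs
    _ ≤ Ω := hΩ

lemma ibp2 {ξ A B : ℝ} (hξ : 0 < ξ) (hA : 1 < A) (hAB : B - A = 1) {n h : ℕ} (hn : 1 ≤ n)
    {g g' w : ℝ → ℝ} {κ Ω : ℝ} (hg'c : Continuous g')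
    (hg : ∀ x, HasDerivAt g (g' x) x) (hg0 : ∀ x, 0 ≤ g x) (hκ0 : 0 ≤ κ)
    (hκ : ∀ x ∈ Set.Icc A B, |g' x| ≤ κ * g x * (ξ * (n * x ^ (n - 1))))
    (hw : Continuous w) (hΩ : ∀ y, |∫ x in (0:ℝ)..y, w x| ≤ Ω) :
    |∫ x in A..B, g x * w (ξ * x ^ (n + h))| ≤
      Ω * ((A⁻¹) ^ h * (3 * κ + 5 / ξ)) * ∫ x in A..B, g x := by
  have hgc : Continuous g := continuous_iff_continuousAt.2 fun x => (hg x).continuousAt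
  have hAB' : A ≤ B := by linarith
  have hn' : (0:ℝ) < n := by exact_mod_cast hn
  have hpos : ∀ x ∈ Set.Icc A B, 0 < x := fun x hx => by linarith [hx.1]
  have hΩ0 : 0 ≤ Ω := (abs_nonneg _).trans (hΩ 0)
  have hWd : ∀ y, HasDerivAt (fun y => ∫ x in (0:ℝ)..y, w x) (w y) y := fun y =>
    intervalIntegral.integral_hasDerivAt_right (hw.intervalIntegrable _ _)
      (hw.stronglyMeasurableAtFilter _ _) hw.continuousAt
  have hWc : Continuous (fun y => ∫ x in (0:ℝ)..y, w x) :=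
    continuous_iff_continuousAt.2 fun x => (hWd x).continuousAt
  have h1 := ibp hξ hA hAB' (n := n + h) (by omega) Set.countable_empty hg hg'c hg0 hWc
    (fun y _ => hWd y) hΩ
    ((by fun_prop : Continuous fun x => w (ξ * x ^ (n + h))).intervalIntegrable _ _)
  obtain ⟨hbA, hbB⟩ := bdry hξ hA hAB hn hg hg0 hκ
  have hrA := ratio_inv hξ hA le_rfl (Nat.le_add_right n h) hn
  have hrB := ratio_inv hξ hA hAB' (Nat.le_add_right n h) hn
  rw [Nat.add_sub_cancel_left] at hrA hrB
  have hr0 : 0 ≤ (A⁻¹) ^ h := by positivity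
  have h2 : ∫ x in A..B, (|g' x| * (ξ * ((n + h : ℕ) * x ^ (n + h - 1)))⁻¹
      + g x * (ξ * x ^ (n + h))⁻¹) ≤ ∫ x in A..B, ((A⁻¹) ^ h * (κ + 1 / ξ)) * g x := by
    have hu : Set.uIcc A B = Set.Icc A B := Set.uIcc_of_le hAB'
    apply intervalIntegral.integral_mono_on hAB'
    · apply ContinuousOn.intervalIntegrable
      rw [hu]
      apply ContinuousOn.add
      · apply (by fun_prop : Continuous fun x => |g' x|).continuousOn.mul
        exact fun x hx => (v_deriv hξ (by omega) (hpos x hx)).continuousAt.continuousWithinAt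
      · apply hgc.continuousOn.mul
        apply ContinuousOn.inv₀ (by fun_prop)
        intro x hx
        have := hpos x hx
        positivity
    · exact (by fun_prop : Continuous _).intervalIntegrable _ _
    · intro x hx
      have hx0 := hpos x hx
      have hr := ratio hξ hA hx.1 (Nat.le_add_right n h) (by omega)
      rw [Nat.add_sub_cancel_left] at hr
      have e1 : |g' x| * (ξ * ((n + h : ℕ) * x ^ (n + h - 1)))⁻¹ ≤ κ * g x * (A⁻¹) ^ h := by
        have hp : 0 ≤ (ξ * ((n + h : ℕ) * x ^ (n + h - 1)))⁻¹ := by positivity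
        calc _ ≤ κ * g x * (ξ * (n * x ^ (n - 1))) * (ξ * ((n + h : ℕ) * x ^ (n + h - 1)))⁻¹ :=
              mul_le_mul_of_nonneg_right (hκ x hx) hp
          _ = κ * g x * ((ξ * (n * x ^ (n - 1))) * (ξ * ((n + h : ℕ) * x ^ (n + h - 1)))⁻¹) := by
              ring
          _ ≤ _ := mul_le_mul_of_nonneg_left hr (mul_nonneg hκ0 (hg0 x))
      have e2 : (ξ * x ^ (n + h))⁻¹ ≤ (A⁻¹) ^ h * (1 / ξ) := by
        rw [inv_pow, one_div, ← mul_inv]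
        apply inv_anti₀ (by positivity)
        have : A ^ h ≤ x ^ (n + h) := by
          calc A ^ h ≤ x ^ h := by gcongr; exact hx.1
            _ ≤ x ^ (n + h) := pow_le_pow_right₀ (by linarith [hx.1]) (by omega)
        nlinarith
      have := mul_le_mul_of_nonneg_left e2 (hg0 x)
      linarith
  rw [intervalIntegral.integral_const_mul] at h2
  refine h1.trans ?_
  rw [mul_assoc Ω]
  apply mul_le_mul_of_nonneg_left _ hΩ0
  have e1 := mul_le_mul_of_nonneg_left hrA (hg0 A)
  have e2 := mul_le_mul_of_nonneg_left hrB (hg0 B)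
  have e3 := mul_le_mul_of_nonneg_left hbA hr0
  have e4 := mul_le_mul_of_nonneg_left hbB hr0
  have : (A⁻¹) ^ h * (3 * κ + 5 / ξ) * ∫ x in A..B, g x =
     (A⁻¹) ^ h * ((κ + 2 / ξ) * ∫ x in A..B, g x) + (A⁻¹) ^ h * ((κ + 2 / ξ) * ∫ x in A..B, g x)
      + (A⁻¹) ^ h * (κ + 1 / ξ) * ∫ x in A..B, g x := by ring
  rw [this]
  linarith

lemma wl {ξ A B : ℝ} (hξ : 0 < ξ) (hA : 1 < A) (hAB : B - A = 1) {n h : ℕ} (hn : 1 ≤ n)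
    {g g' w : ℝ → ℝ} {κ m : ℝ} (hg'c : Continuous g')
    (hg : ∀ x, HasDerivAt g (g' x) x) (hg0 : ∀ x, 0 ≤ g x) (hκ0 : 0 ≤ κ)
    (hκ : ∀ x ∈ Set.Icc A B, |g' x| ≤ κ * g x * (ξ * (n * x ^ (n - 1))))
    (hw : Continuous w) (hw0 : ∀ x, 0 ≤ w x) (hp : ∀ x, w (x + 1) = w x)
    (hm : ∫ x in (0:ℝ)..1, w x ≤ m) :
    ∫ x in A..B, g x * w (ξ * x ^ (n + h)) ≤
      m * (1 + 2 * ((A⁻¹) ^ h * (3 * κ + 5 / ξ))) * ∫ x in A..B, g x := by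
  have hgc : Continuous g := continuous_iff_continuousAt.2 fun x => (hg x).continuousAt
  have hAB' : A ≤ B := by linarith
  set m0 := ∫ x in (0:ℝ)..1, w x with hm0
  have hm00 : 0 ≤ m0 := intervalIntegral.integral_nonneg (by norm_num) fun x _ => hw0 x
  have hwc : Continuous (fun x => w x - m0) := by fun_prop
  have h1 := ibp2 (w := fun x => w x - m0) (Ω := 2 * m0) (h := h) hξ hA hAB hn hg'c hg hg0 hκ0 hκ hwc
    (pw (by intro x; simp [hp]) (fun a b => hwc.intervalIntegrable a b)
      (by rw [intervalIntegral.integral_sub (hw.intervalIntegrable _ _) (by simp)]; simp [← hm0])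
      (by
        calc ∫ x in (0:ℝ)..1, |w x - m0| ≤ ∫ x in (0:ℝ)..1, (w x + m0) := by
              apply intervalIntegral.integral_mono_on (by norm_num)
              · exact (by fun_prop : Continuous _).intervalIntegrable _ _
              · exact (by fun_prop : Continuous _).intervalIntegrable _ _
              · intro x _
                have := hw0 x
                rw [abs_le]; constructor <;> linarith
          _ = 2 * m0 := by
              rw [intervalIntegral.integral_add (hw.intervalIntegrable _ _) (by simp)]
              simp [← hm0]; ring))
  have h2 : ∫ x in A..B, g x * (w (ξ * x ^ (n + h)) - m0) =
      (∫ x in A..B, g x * w (ξ * x ^ (n + h))) - m0 * ∫ x in A..B, g x := by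
    rw [← intervalIntegral.integral_const_mul, ← intervalIntegral.integral_sub]
    · congr 1; ext x; ring
    · exact (by fun_prop : Continuous _).intervalIntegrable _ _
    · exact (by fun_prop : Continuous _).intervalIntegrable _ _
  have h3 := (abs_le.1 h1).2
  rw [h2] at h3
  have hI : 0 ≤ ∫ x in A..B, g x := intervalIntegral.integral_nonneg hAB' fun x _ => hg0 x
  have hr0 : 0 ≤ (A⁻¹) ^ h * (3 * κ + 5 / ξ) := by positivity
  calc ∫ x in A..B, g x * w (ξ * x ^ (n + h))
      ≤ m0 * (1 + 2 * ((A⁻¹) ^ h * (3 * κ + 5 / ξ))) * ∫ x in A..B, g x := by linarith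
    _ ≤ _ := by gcongr

structure Good (f f' : ℝ → ℝ) (D σ : ℝ) : Prop where
  hd : ∀ y, HasDerivAt f (f' y) y
  hc : Continuous f'
  per : ∀ x, f (x + 1) = f x
  per' : ∀ x, f' (x + 1) = f' x
  mean : ∫ x in (0:ℝ)..1, f x = 0
  bd : ∀ x, |f x| ≤ 2
  hD : ∀ x, |f' x| ≤ D
  l1 : ∫ x in (0:ℝ)..1, |f x| ≤ σ
  var : ∫ x in (0:ℝ)..1, |f' x| ≤ 4

noncomputable def Sm (ξ : ℝ) (f : ℝ → ℝ) (a : ℕ → ℝ) (n : ℕ) (x : ℝ) : ℝ :=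
  ∑ k ∈ Finset.range (n + 1), a k * f (ξ * x ^ k)

noncomputable def Sd (ξ : ℝ) (f' : ℝ → ℝ) (a : ℕ → ℝ) (n : ℕ) (x : ℝ) : ℝ :=
  ∑ k ∈ Finset.range (n + 1), a k * (f' (ξ * x ^ k) * (ξ * (k * x ^ (k - 1))))

noncomputable def GG (ξ lam : ℝ) (f : ℝ → ℝ) (a : ℕ → ℝ) (n : ℕ) (x : ℝ) : ℝ :=
  Real.exp (lam * Sm ξ f a n x)

noncomputable def Gd (ξ lam : ℝ) (f f' : ℝ → ℝ) (a : ℕ → ℝ) (n : ℕ) (x : ℝ) : ℝ :=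
  GG ξ lam f a n x * (lam * Sd ξ f' a n x)

lemma Good.cont {f f' : ℝ → ℝ} {D σ : ℝ} (H : Good f f' D σ) : Continuous f :=
  continuous_iff_continuousAt.2 fun x => (H.hd x).continuousAt

lemma GG_deriv {f f' : ℝ → ℝ} {D σ : ℝ} (H : Good f f' D σ) (ξ lam : ℝ) (a : ℕ → ℝ) (n : ℕ) (x : ℝ) :
    HasDerivAt (GG ξ lam f a n) (Gd ξ lam f f' a n x) x := by
  have h1 : HasDerivAt (fun x => Sm ξ f a n x) (Sd ξ f' a n x) x := by
    unfold Sm Sd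
    apply HasDerivAt.fun_sum
    intro k _
    exact ((H.hd _).comp x (ph_deriv (ξ := ξ) (n := k) x)).const_mul (a k)
  exact (h1.const_mul lam).exp

lemma GG_pos (ξ lam : ℝ) (f : ℝ → ℝ) (a : ℕ → ℝ) (n : ℕ) (x : ℝ) : 0 < GG ξ lam f a n x :=
  Real.exp_pos _

lemma GG_cont {f f' : ℝ → ℝ} {D σ : ℝ} (H : Good f f' D σ) (ξ lam : ℝ) (a : ℕ → ℝ) (n : ℕ) :
    Continuous (GG ξ lam f a n) :=
  continuous_iff_continuousAt.2 fun x => (GG_deriv H ξ lam a n x).continuousAt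

lemma Gd_cont {f f' : ℝ → ℝ} {D σ : ℝ} (H : Good f f' D σ) (ξ lam : ℝ) (a : ℕ → ℝ) (n : ℕ) :
    Continuous (Gd ξ lam f f' a n) := by
  have h1 := GG_cont H ξ lam a n
  have h2 := H.hc
  unfold Gd Sd
  fun_prop

lemma geo_rev_le {r : ℝ} (hr0 : 0 ≤ r) (hr1 : r < 1) (n : ℕ) :
    ∑ k ∈ Finset.range (n + 1), r ^ (n - k) ≤ (1 - r)⁻¹ := by
  have := Finset.sum_range_reflect (fun k => r ^ k) (n + 1)
  simp only [Nat.add_sub_cancel] at this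
  rw [this]
  have h1 := geom_sum_mul_neg r (n+1)
  rw [← one_div, le_div_iff₀ (by linarith), h1]
  have : 0 ≤ r ^ (n+1) := by positivity
  linarith

lemma Sd_bound {f f' : ℝ → ℝ} {D σ : ℝ} (H : Good f f' D σ) {ξ A x : ℝ} (hξ : 0 < ξ) (hA : 1 < A)
    (hx : A ≤ x) {a : ℕ → ℝ} (ha : ∀ k, a k = 0 ∨ a k = 1) {n : ℕ} (hn : 1 ≤ n) :
    |Sd ξ f' a n x| ≤ D * (1 - A⁻¹)⁻¹ * (ξ * (n * x ^ (n - 1))) := by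
  have hx0 : 0 < x := by linarith
  have hn' : (0:ℝ) < n := by exact_mod_cast hn
  have hD0 : 0 ≤ D := (abs_nonneg _).trans (H.hD 0)
  have hp : 0 < ξ * (n * x ^ (n - 1)) := by positivity
  calc |Sd ξ f' a n x| ≤ ∑ k ∈ Finset.range (n + 1),
        |a k * (f' (ξ * x ^ k) * (ξ * (k * x ^ (k - 1))))| := Finset.abs_sum_le_sum_abs _ _
    _ ≤ ∑ k ∈ Finset.range (n + 1), D * (A⁻¹) ^ (n - k) * (ξ * (n * x ^ (n - 1))) := by
        apply Finset.sum_le_sum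
        intro k hk
        have hk' : k ≤ n := by simpa [Nat.lt_succ_iff] using hk
        have h1 := ratio hξ hA hx hk' hn
        rw [← div_eq_mul_inv, div_le_iff₀ hp] at h1
        have h2 : |a k| ≤ 1 := by rcases ha k with h | h <;> simp [h]
        have h3 : 0 ≤ ξ * (k * x ^ (k - 1)) := by positivity
        rw [abs_mul, abs_mul, abs_of_nonneg h3]
        calc |a k| * (|f' (ξ * x ^ k)| * (ξ * (k * x ^ (k - 1))))
            ≤ 1 * (D * ((A⁻¹) ^ (n - k) * (ξ * (n * x ^ (n - 1))))) := by
              gcongr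
              exact H.hD _
          _ = _ := by ring
    _ = D * (∑ k ∈ Finset.range (n + 1), (A⁻¹) ^ (n - k)) * (ξ * (n * x ^ (n - 1))) := by
        rw [Finset.mul_sum, Finset.sum_mul]
    _ ≤ _ := by
        have := geo_rev_le (r := A⁻¹) (by positivity) (inv_lt_one_of_one_lt₀ hA) n
        gcongr

lemma GG_comp {f f' : ℝ → ℝ} {D σ : ℝ} (H : Good f f' D σ) {ξ lam x : ℝ} (hl : 0 ≤ lam)
    {a : ℕ → ℝ} (ha : ∀ k, a k = 0 ∨ a k = 1) {m n h : ℕ} (hmn : m ≤ n) (hh : n ≤ m + 2 * h)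
    (hlh : 4 * lam * h ≤ 1) :
    GG ξ lam f a n x ≤ 3 * GG ξ lam f a m x ∧ GG ξ lam f a m x ≤ 3 * GG ξ lam f a n x := by
  have h1 : |Sm ξ f a n x - Sm ξ f a m x| ≤ 4 * h := by
    unfold Sm
    rw [← Finset.sum_range_add_sum_Ico _ (show m + 1 ≤ n + 1 by omega), add_sub_cancel_left]
    calc _ ≤ ∑ k ∈ Finset.Ico (m + 1) (n + 1), |a k * f (ξ * x ^ k)| :=
          Finset.abs_sum_le_sum_abs _ _
      _ ≤ ∑ k ∈ Finset.Ico (m + 1) (n + 1), (2:ℝ) := by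
          apply Finset.sum_le_sum
          intro k _
          have := H.bd (ξ * x ^ k)
          rcases ha k with h | h <;> simp [h, this]
      _ = ((n - m : ℕ) : ℝ) * 2 := by simp
      _ ≤ ((2 * h : ℕ) : ℝ) * 2 := by gcongr; omega
      _ = 4 * h := by push_cast; ring
  have h2 := abs_le.1 h1
  have h3 : Real.exp 1 ≤ 3 := by linarith [Real.exp_one_lt_d9]
  unfold GG
  constructor
  · calc _ ≤ Real.exp (1 + lam * Sm ξ f a m x) := by
          apply Real.exp_le_exp.2; nlinarith
      _ = Real.exp 1 * _ := Real.exp_add _ _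
      _ ≤ _ := by gcongr
  · calc _ ≤ Real.exp (1 + lam * Sm ξ f a n x) := by
          apply Real.exp_le_exp.2; nlinarith
      _ = Real.exp 1 * _ := Real.exp_add _ _
      _ ≤ _ := by gcongr

lemma GG_kappa {f f' : ℝ → ℝ} {D σ : ℝ} (H : Good f f' D σ) {ξ A lam x : ℝ} (hξ : 0 < ξ) (hA : 1 < A)
    (hl : 0 ≤ lam) (hx : A ≤ x) {a : ℕ → ℝ} (ha : ∀ k, a k = 0 ∨ a k = 1) {n : ℕ} (hn : 1 ≤ n) :
    |Gd ξ lam f f' a n x| ≤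
      (lam * D * (1 - A⁻¹)⁻¹) * GG ξ lam f a n x * (ξ * (n * x ^ (n - 1))) := by
  have h1 := Sd_bound H hξ hA hx ha hn
  have h2 := GG_pos ξ lam f a n x
  unfold Gd
  rw [abs_mul, abs_mul, abs_of_pos h2, abs_of_nonneg hl]
  calc _ ≤ GG ξ lam f a n x * (lam * (D * (1 - A⁻¹)⁻¹ * (ξ * (n * x ^ (n - 1))))) := by gcongr
    _ = _ := by ring

lemma dec {f f' : ℝ → ℝ} {D σ : ℝ} (H : Good f f' D σ) {ξ A B lam : ℝ} (hξ : 0 < ξ) (hA : 1 < A)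
    (hAB : B - A = 1) (hl : 0 ≤ lam) (hl1 : lam ≤ 1) {a : ℕ → ℝ} (ha : ∀ k, a k = 0 ∨ a k = 1)
    {h k n : ℕ} (hlh : 4 * lam * h ≤ 1)
    (hr : (A⁻¹) ^ h * (3 * (lam * D * (1 - A⁻¹)⁻¹) + 5 / ξ) ≤ lam)
    (hk : h < k) (hkn : k ≤ n + h) (hnk : n ≤ k + h) {w : ℝ → ℝ} {m : ℝ}
    (hw : Continuous w) (hw0 : ∀ x, 0 ≤ w x) (hp : ∀ x, w (x + 1) = w x)
    (hm : ∫ x in (0:ℝ)..1, w x ≤ m) :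
    ∫ x in A..B, GG ξ lam f a n x * w (ξ * x ^ k) ≤ 27 * m * ∫ x in A..B, GG ξ lam f a n x := by
  have hAB' : A ≤ B := by linarith
  have hD0 : 0 ≤ D := (abs_nonneg _).trans (H.hD 0)
  have hρ : 0 ≤ (1 - A⁻¹)⁻¹ := inv_nonneg.2 (by linarith [inv_lt_one_of_one_lt₀ hA])
  obtain ⟨e, rfl⟩ : ∃ e, k = e + h := ⟨k - h, by omega⟩
  have hm0 : 0 ≤ m := (intervalIntegral.integral_nonneg (by norm_num) fun x _ => hw0 x).trans hm
  have h1 := wl (h := h) hξ hA hAB (show 1 ≤ e by omega) (Gd_cont H ξ lam a e) (GG_deriv H ξ lam a e)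
    (fun x => (GG_pos ξ lam f a e x).le) (by positivity)
    (fun x hx => GG_kappa H hξ hA hl hx.1 ha (by omega)) hw hw0 hp hm
  have hcn := GG_cont H ξ lam a n
  have hce := GG_cont H ξ lam a e
  have h2 : ∫ x in A..B, GG ξ lam f a n x * w (ξ * x ^ (e + h)) ≤
      ∫ x in A..B, 3 * (GG ξ lam f a e x * w (ξ * x ^ (e + h))) := by
    apply intervalIntegral.integral_mono_on hAB'
    · exact (by fun_prop : Continuous _).intervalIntegrable _ _
    · exact (by fun_prop : Continuous _).intervalIntegrable _ _
    · intro x _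
      have := (GG_comp H (ξ := ξ) (x := x) hl ha (show e ≤ n by omega) (by omega) hlh).1
      have := mul_le_mul_of_nonneg_right this (hw0 (ξ * x ^ (e + h)))
      linarith
  have h3 : ∫ x in A..B, GG ξ lam f a e x ≤ ∫ x in A..B, 3 * GG ξ lam f a n x := by
    apply intervalIntegral.integral_mono_on hAB'
    · exact (by fun_prop : Continuous _).intervalIntegrable _ _
    · exact (by fun_prop : Continuous _).intervalIntegrable _ _
    · intro x _
      exact (GG_comp H (ξ := ξ) (x := x) hl ha (show e ≤ n by omega) (by omega) hlh).2
  rw [intervalIntegral.integral_const_mul] at h2 h3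
  have hIe : 0 ≤ ∫ x in A..B, GG ξ lam f a e x :=
    intervalIntegral.integral_nonneg hAB' fun x _ => (GG_pos ξ lam f a e x).le
  calc _ ≤ _ := h2
    _ ≤ 3 * (m * (1 + 2 * 1) * ∫ x in A..B, GG ξ lam f a e x) := by
        refine mul_le_mul_of_nonneg_left (h1.trans ?_) (by norm_num)
        gcongr
        exact hr.trans hl1
    _ ≤ 3 * (m * (1 + 2 * 1) * (3 * ∫ x in A..B, GG ξ lam f a n x)) := by gcongr
    _ = _ := by ring

lemma main_term {f f' : ℝ → ℝ} {D σ : ℝ} (H : Good f f' D σ) {ξ A B lam : ℝ} (hξ : 0 < ξ)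
    (hA : 1 < A) (hAB : B - A = 1) (hl : 0 ≤ lam) (hl1 : lam ≤ 1) {a : ℕ → ℝ}
    (ha : ∀ k, a k = 0 ∨ a k = 1)
    {h n : ℕ} (hh : 1 ≤ h) (ha0 : ∀ k, k ≤ h → a k = 0) (hlh : 4 * lam * h ≤ 1)
    (hr : (A⁻¹) ^ h * (3 * (lam * D * (1 - A⁻¹)⁻¹) + 5 / ξ) ≤ lam) (hn : h ≤ n) :
    |∫ x in A..B, GG ξ lam f a n x * f (ξ * x ^ (n + 1))| ≤
      σ * (lam * (20 + 108 * (1 - A⁻¹)⁻¹) * ∫ x in A..B, GG ξ lam f a n x) := by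
  have hAB' : A ≤ B := by linarith
  have hu : Set.uIcc A B = Set.Icc A B := Set.uIcc_of_le hAB'
  have hpos : ∀ x ∈ Set.Icc A B, 0 < x := fun x hx => by linarith [hx.1]
  have hD0 : 0 ≤ D := (abs_nonneg _).trans (H.hD 0)
  set ρ := (1 - A⁻¹)⁻¹ with hρd
  have hρ : 0 ≤ ρ := inv_nonneg.2 (by linarith [inv_lt_one_of_one_lt₀ hA])
  obtain ⟨e, he⟩ : ∃ e, n + 1 = e + h := ⟨n + 1 - h, by omega⟩
  have he1 : 1 ≤ e := by omega
  have hen : e ≤ n := by omega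
  set κ := lam * D * ρ with hκ
  have hκ0 : 0 ≤ κ := by positivity
  have hr0 : 0 ≤ (A⁻¹) ^ h := by positivity
  have hfc := H.cont
  have hf'c := H.hc
  have hcn := GG_cont H ξ lam a n
  have hce := GG_cont H ξ lam a e
  have hσ0 : 0 ≤ σ :=
    (intervalIntegral.integral_nonneg (by norm_num) fun x _ => abs_nonneg _).trans H.l1
  have hWd : ∀ y, HasDerivAt (fun y => ∫ x in (0:ℝ)..y, f x) (f y) y := fun y =>
    intervalIntegral.integral_hasDerivAt_right (hfc.intervalIntegrable _ _)
      (hfc.stronglyMeasurableAtFilter _ _) hfc.continuousAt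
  have hWc : Continuous (fun y => ∫ x in (0:ℝ)..y, f x) :=
    continuous_iff_continuousAt.2 fun x => (hWd x).continuousAt
  have h1 := ibp hξ hA hAB' (n := n + 1) (by omega) Set.countable_empty (GG_deriv H ξ lam a n)
    (Gd_cont H ξ lam a n) (fun x => (GG_pos ξ lam f a n x).le) hWc
    (fun y _ => hWd y) (pw H.per (fun a b => hfc.intervalIntegrable a b) H.mean H.l1)
    ((by fun_prop : Continuous fun x => f (ξ * x ^ (n + 1))).intervalIntegrable _ _)
  refine h1.trans (mul_le_mul_of_nonneg_left ?_ hσ0)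
  set I := ∫ x in A..B, GG ξ lam f a n x with hI
  have hI0 : 0 ≤ I := intervalIntegral.integral_nonneg hAB' fun x _ => (GG_pos ξ lam f a n x).le
  have hIe : ∫ x in A..B, GG ξ lam f a e x ≤ 3 * I := by
    rw [hI, ← intervalIntegral.integral_const_mul]
    apply intervalIntegral.integral_mono_on hAB'
    · exact (by fun_prop : Continuous _).intervalIntegrable _ _
    · exact (by fun_prop : Continuous _).intervalIntegrable _ _
    · intro x _
      exact (GG_comp H (ξ := ξ) (x := x) hl ha hen (by omega) hlh).2
  obtain ⟨hbA, hbB⟩ := bdry hξ hA hAB he1 (GG_deriv H ξ lam a e)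
    (fun x => (GG_pos ξ lam f a e x).le) (fun x hx => GG_kappa H hξ hA hl hx.1 ha he1)
  have hbig : (A⁻¹) ^ h * (κ + 2 / ξ) ≤ lam := by
    refine le_trans ?_ hr
    apply mul_le_mul_of_nonneg_left _ hr0
    have : 2 / ξ ≤ 5 / ξ := by gcongr; norm_num
    linarith
  have bd : ∀ y, A ≤ y → GG ξ lam f a e y * (ξ * (e * y ^ (e - 1)))⁻¹ ≤
      (κ + 2 / ξ) * ∫ x in A..B, GG ξ lam f a e x →
      GG ξ lam f a n y * (ξ * ((n + 1 : ℕ) * y ^ (n + 1 - 1)))⁻¹ ≤ 9 * lam * I := by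
    intro y hy hb
    have hy0 : 0 < y := by linarith
    have e1 := ratio_inv hξ hA hy (show e ≤ n + 1 by omega) he1
    rw [show n + 1 - e = h by omega] at e1
    have e2 := (GG_comp H (ξ := ξ) (x := y) hl ha hen (by omega) hlh).1
    have e3 := (GG_pos ξ lam f a e y).le
    calc _ ≤ (3 * GG ξ lam f a e y) * ((A⁻¹) ^ h * (ξ * (e * y ^ (e - 1)))⁻¹) := by gcongr
      _ = 3 * ((A⁻¹) ^ h * (GG ξ lam f a e y * (ξ * (e * y ^ (e - 1)))⁻¹)) := by ring
      _ ≤ 3 * ((A⁻¹) ^ h * ((κ + 2 / ξ) * (3 * I))) := by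
          have hb2 := hb.trans (mul_le_mul_of_nonneg_left hIe (show 0 ≤ κ + 2 / ξ by positivity))
          exact mul_le_mul_of_nonneg_left (mul_le_mul_of_nonneg_left hb2 hr0) (by norm_num)
      _ = 9 * ((A⁻¹) ^ h * (κ + 2 / ξ)) * I := by ring
      _ ≤ _ := by gcongr
  have bA := bd A le_rfl hbA
  have bB := bd B hAB' hbB
  have hint : ∫ x in A..B, (|Gd ξ lam f f' a n x| * (ξ * ((n + 1 : ℕ) * x ^ (n + 1 - 1)))⁻¹
      + GG ξ lam f a n x * (ξ * x ^ (n + 1))⁻¹) ≤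
      ∫ x in A..B, (2 * lam * GG ξ lam f a n x + lam * ∑ k ∈ Finset.Ico (e + 1) (n + 1),
        (A⁻¹) ^ (n + 1 - k) * (a k * (GG ξ lam f a n x * |f' (ξ * x ^ k)|))) := by
    have hGd := Gd_cont H ξ lam a n
    apply intervalIntegral.integral_mono_on hAB'
    · apply ContinuousOn.intervalIntegrable
      rw [hu]
      apply ContinuousOn.add
      · apply (by fun_prop : Continuous fun x => |Gd ξ lam f f' a n x|).continuousOn.mul
        exact fun x hx => (v_deriv hξ (by omega) (hpos x hx)).continuousAt.continuousWithinAt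
      · apply hcn.continuousOn.mul
        apply ContinuousOn.inv₀ (by fun_prop)
        intro x hx
        have := hpos x hx
        positivity
    · exact (by fun_prop : Continuous _).intervalIntegrable _ _
    · intro x hx
      have hx0 := hpos x hx
      have hG := (GG_pos ξ lam f a n x).le
      set v := (ξ * ((n + 1 : ℕ) * x ^ (n + 1 - 1)))⁻¹ with hv
      have hv0 : 0 ≤ v := by positivity
      have e1 : (ξ * x ^ (n + 1))⁻¹ ≤ lam := by
        have : (ξ * x ^ (n + 1))⁻¹ ≤ (A⁻¹) ^ h * (1 / ξ) := by
          rw [inv_pow, one_div, ← mul_inv]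
          apply inv_anti₀ (by positivity)
          have : A ^ h ≤ x ^ (n + 1) := by
            calc A ^ h ≤ x ^ h := by gcongr; exact hx.1
              _ ≤ x ^ (n + 1) := pow_le_pow_right₀ (by linarith [hx.1]) (by omega)
          nlinarith
        refine this.trans (le_trans ?_ hbig)
        apply mul_le_mul_of_nonneg_left _ hr0
        have : 1 / ξ ≤ 2 / ξ := by gcongr; norm_num
        linarith
      have e2 : Sd ξ f' a n x = Sd ξ f' a e x + ∑ k ∈ Finset.Ico (e + 1) (n + 1),
          a k * (f' (ξ * x ^ k) * (ξ * (k * x ^ (k - 1)))) := by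
        unfold Sd
        rw [Finset.sum_range_add_sum_Ico _ (show e + 1 ≤ n + 1 by omega)]
      have e3 : lam * |Sd ξ f' a e x| * v ≤ lam := by
        have s1 := Sd_bound H hξ hA hx.1 ha he1
        have s2 := ratio hξ hA hx.1 (show e ≤ n + 1 by omega) (by omega)
        rw [show n + 1 - e = h by omega] at s2
        calc _ ≤ lam * (D * ρ * (ξ * (e * x ^ (e - 1)))) * v := by gcongr
          _ = κ * (ξ * (e * x ^ (e - 1)) * v) := by rw [hκ]; ring
          _ ≤ κ * (A⁻¹) ^ h := by gcongr
          _ ≤ (A⁻¹) ^ h * (κ + 2 / ξ) := by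
            have : 0 ≤ (A⁻¹) ^ h * (2 / ξ) := by positivity
            linarith
          _ ≤ _ := hbig
      have e4 : |∑ k ∈ Finset.Ico (e + 1) (n + 1),
          a k * (f' (ξ * x ^ k) * (ξ * (k * x ^ (k - 1))))| * v ≤
          ∑ k ∈ Finset.Ico (e + 1) (n + 1), (A⁻¹) ^ (n + 1 - k) * (a k * |f' (ξ * x ^ k)|) := by
        refine (mul_le_mul_of_nonneg_right (Finset.abs_sum_le_sum_abs _ _) hv0).trans ?_
        rw [Finset.sum_mul]
        apply Finset.sum_le_sum
        intro k hk
        have hk' : k ≤ n + 1 := by have := (Finset.mem_Ico.1 hk).2; omega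
        have s2 := ratio hξ hA hx.1 hk' (by omega)
        have hak : 0 ≤ a k := by rcases ha k with h | h <;> simp [h]
        have h3 : 0 ≤ ξ * (k * x ^ (k - 1)) := by positivity
        rw [abs_mul, abs_mul, abs_of_nonneg h3, abs_of_nonneg hak]
        calc _ = (ξ * (k * x ^ (k - 1)) * v) * (a k * |f' (ξ * x ^ k)|) := by ring
          _ ≤ _ := by gcongr
      have e5 : |Gd ξ lam f f' a n x| * v ≤ lam * GG ξ lam f a n x + lam * (GG ξ lam f a n x *
          ∑ k ∈ Finset.Ico (e + 1) (n + 1), (A⁻¹) ^ (n + 1 - k) * (a k * |f' (ξ * x ^ k)|)) := by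
        unfold Gd
        rw [abs_mul, abs_mul, abs_of_nonneg hG, abs_of_nonneg hl, e2]
        calc _ ≤ GG ξ lam f a n x * (lam * (|Sd ξ f' a e x| + |∑ k ∈ Finset.Ico (e + 1) (n + 1),
          a k * (f' (ξ * x ^ k) * (ξ * (k * x ^ (k - 1))))|)) * v := by
              gcongr; exact abs_add_le _ _
          _ = GG ξ lam f a n x * (lam * |Sd ξ f' a e x| * v) + GG ξ lam f a n x * (lam *
            (|∑ k ∈ Finset.Ico (e + 1) (n + 1),
          a k * (f' (ξ * x ^ k) * (ξ * (k * x ^ (k - 1))))| * v)) := by ring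
          _ ≤ GG ξ lam f a n x * lam + GG ξ lam f a n x * (lam *
             ∑ k ∈ Finset.Ico (e + 1) (n + 1), (A⁻¹) ^ (n + 1 - k) * (a k * |f' (ξ * x ^ k)|)) := by
              gcongr
          _ = _ := by ring
      have e6 : GG ξ lam f a n x * (ξ * x ^ (n + 1))⁻¹ ≤ lam * GG ξ lam f a n x := by
        rw [mul_comm]; gcongr
      have e7 : GG ξ lam f a n x *
          ∑ k ∈ Finset.Ico (e + 1) (n + 1), (A⁻¹) ^ (n + 1 - k) * (a k * |f' (ξ * x ^ k)|) =
          ∑ k ∈ Finset.Ico (e + 1) (n + 1),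
            (A⁻¹) ^ (n + 1 - k) * (a k * (GG ξ lam f a n x * |f' (ξ * x ^ k)|)) := by
        rw [Finset.mul_sum]
        apply Finset.sum_congr rfl
        intro k _; ring
      rw [e7] at e5
      linarith
  have hint2 : ∫ x in A..B, (2 * lam * GG ξ lam f a n x + lam * ∑ k ∈ Finset.Ico (e + 1) (n + 1),
        (A⁻¹) ^ (n + 1 - k) * (a k * (GG ξ lam f a n x * |f' (ξ * x ^ k)|))) ≤
      2 * lam * I + lam * (108 * ρ * I) := by
    rw [intervalIntegral.integral_add, intervalIntegral.integral_const_mul,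
      intervalIntegral.integral_const_mul, intervalIntegral.integral_finsetSum]
    · gcongr
      calc _ ≤ ∑ k ∈ Finset.Ico (e + 1) (n + 1), (A⁻¹) ^ (n + 1 - k) * (108 * I) := by
            apply Finset.sum_le_sum
            intro k hk
            have hk' := Finset.mem_Ico.1 hk
            rw [intervalIntegral.integral_const_mul, intervalIntegral.integral_const_mul]
            apply mul_le_mul_of_nonneg_left _ (by positivity)
            rcases ha k with hak | hak
            · rw [hak]; simp; positivity
            · have hkh : h < k := by
                by_contra hc
                have := ha0 k (by omega)
                rw [hak] at this; norm_num at this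
              rw [hak, one_mul]
              have := dec H hξ hA hAB hl hl1 ha hlh hr hkh (show k ≤ n + h by omega)
                (show n ≤ k + h by omega) (w := fun y => |f' y|) (m := 4) (by fun_prop)
                (fun x => abs_nonneg _) (fun x => by rw [H.per']) H.var
              linarith
        _ ≤ ∑ k ∈ Finset.range (n + 1 + 1), (A⁻¹) ^ (n + 1 - k) * (108 * I) := by
            apply Finset.sum_le_sum_of_subset_of_nonneg
            · intro k hk
              have hk' := Finset.mem_Ico.1 hk
              simp; omega
            · intro k _ _
              positivity
        _ = (∑ k ∈ Finset.range (n + 1 + 1), (A⁻¹) ^ (n + 1 - k)) * (108 * I) := by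
            rw [Finset.sum_mul]
        _ ≤ ρ * (108 * I) := by
            gcongr
            exact geo_rev_le (by positivity) (inv_lt_one_of_one_lt₀ hA) _
        _ = _ := by ring
    · intro k _
      exact (by fun_prop : Continuous _).intervalIntegrable _ _
    · exact (by fun_prop : Continuous _).intervalIntegrable _ _
    · exact (by fun_prop : Continuous _).intervalIntegrable _ _
  have : lam * (20 + 108 * ρ) * I = 9 * lam * I + 9 * lam * I +
    (2 * lam * I + lam * (108 * ρ * I)) := by ring
  rw [this]
  linarith

lemma step {f f' : ℝ → ℝ} {D σ : ℝ} (H : Good f f' D σ) {ξ A B lam : ℝ} (hξ : 0 < ξ)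
    (hA : 1 < A) (hAB : B - A = 1) (hl : 0 ≤ lam) {a : ℕ → ℝ}
    (ha : ∀ k, a k = 0 ∨ a k = 1)
    {h n : ℕ} (hh : 1 ≤ h) (ha0 : ∀ k, k ≤ h → a k = 0) (hlh : 4 * lam * h ≤ 1)
    (hr : (A⁻¹) ^ h * (3 * (lam * D * (1 - A⁻¹)⁻¹) + 5 / ξ) ≤ lam) (hn : h ≤ n)
    (han : a (n + 1) = 1) :
    ∫ x in A..B, GG ξ lam f a (n + 1) x ≤
      (1 + (74 + 108 * (1 - A⁻¹)⁻¹) * lam ^ 2 * σ) * ∫ x in A..B, GG ξ lam f a n x := by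
  have hAB' : A ≤ B := by linarith
  have hh' : (1:ℝ) ≤ h := by exact_mod_cast hh
  have hl4 : 4 * lam ≤ 1 := by nlinarith
  have h1 := main_term H hξ hA hAB hl (by linarith) ha hh ha0 hlh hr hn
  have hfc := H.cont
  have hcn := GG_cont H ξ lam a n
  have hcn1 := GG_cont H ξ lam a (n + 1)
  have h2 := dec H hξ hA hAB hl (by linarith) ha hlh hr (show h < n + 1 by omega)
    (show n + 1 ≤ n + h by omega) (show n ≤ n + 1 + h by omega) (w := fun y => (f y) ^ 2)
    (m := 2 * σ) (by fun_prop) (fun x => sq_nonneg _) (fun x => by rw [H.per])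
    (by
      calc ∫ x in (0:ℝ)..1, (f x) ^ 2 ≤ ∫ x in (0:ℝ)..1, 2 * |f x| := by
            apply intervalIntegral.integral_mono_on (by norm_num)
            · exact (by fun_prop : Continuous _).intervalIntegrable _ _
            · exact (by fun_prop : Continuous _).intervalIntegrable _ _
            · intro x _
              have := H.bd x
              rw [← sq_abs]
              nlinarith [abs_nonneg (f x)]
        _ = 2 * ∫ x in (0:ℝ)..1, |f x| := by rw [intervalIntegral.integral_const_mul]
        _ ≤ 2 * σ := by linarith [H.l1])
  have h3 : ∫ x in A..B, GG ξ lam f a (n + 1) x ≤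
      ∫ x in A..B, (GG ξ lam f a n x + lam * (GG ξ lam f a n x * f (ξ * x ^ (n + 1))) +
        lam ^ 2 * (GG ξ lam f a n x * (f (ξ * x ^ (n + 1))) ^ 2)) := by
    apply intervalIntegral.integral_mono_on hAB'
    · exact (by fun_prop : Continuous _).intervalIntegrable _ _
    · exact (by fun_prop : Continuous _).intervalIntegrable _ _
    · intro x _
      have e1 : GG ξ lam f a (n + 1) x = GG ξ lam f a n x * Real.exp (lam * f (ξ * x ^ (n + 1))) := by
        unfold GG Sm
        rw [Finset.sum_range_succ _ (n + 1), han, ← Real.exp_add]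
        congr 1; ring
      have e2 : |lam * f (ξ * x ^ (n + 1))| ≤ 1 := by
        rw [abs_mul, abs_of_nonneg hl]
        have := H.bd (ξ * x ^ (n + 1))
        nlinarith
      have e3 := (abs_le.1 (Real.abs_exp_sub_one_sub_id_le e2)).2
      have e4 := (GG_pos ξ lam f a n x).le
      rw [e1]
      calc _ ≤ GG ξ lam f a n x * (1 + lam * f (ξ * x ^ (n + 1)) + (lam * f (ξ * x ^ (n + 1))) ^ 2) := by
            gcongr; linarith
        _ = _ := by ring
  rw [intervalIntegral.integral_add, intervalIntegral.integral_add,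
    intervalIntegral.integral_const_mul, intervalIntegral.integral_const_mul] at h3
  · have h4 := (abs_le.1 h1).2
    have h5 := mul_le_mul_of_nonneg_left h4 hl
    have h6 := mul_le_mul_of_nonneg_left h2 (sq_nonneg lam)
    nlinarith
  all_goals exact (by fun_prop : Continuous _).intervalIntegrable _ _

lemma exp_moment {f f' : ℝ → ℝ} {D σ : ℝ} (H : Good f f' D σ) {ξ A B lam : ℝ} (hξ : 0 < ξ)
    (hA : 1 < A) (hAB : B - A = 1) (hl : 0 ≤ lam) {a : ℕ → ℝ}
    (ha : ∀ k, a k = 0 ∨ a k = 1)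
    {h : ℕ} (hh : 1 ≤ h) (ha0 : ∀ k, k ≤ h → a k = 0) (hlh : 4 * lam * h ≤ 1)
    (hr : (A⁻¹) ^ h * (3 * (lam * D * (1 - A⁻¹)⁻¹) + 5 / ξ) ≤ lam) (n : ℕ) :
    ∫ x in A..B, GG ξ lam f a n x ≤
      Real.exp ((74 + 108 * (1 - A⁻¹)⁻¹) * lam ^ 2 * σ * ∑ k ∈ Finset.range (n + 1), a k) := by
  have hAB' : A ≤ B := by linarith
  induction n with
  | zero =>
    have : ∀ x, GG ξ lam f a 0 x = 1 := by
      intro x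
      simp [GG, Sm, ha0 0 (by omega)]
    simp [this, hAB, ha0 0 (by omega)]
  | succ n ih =>
    rw [Finset.sum_range_succ]
    rcases ha (n + 1) with han | han
    · have : ∀ x, GG ξ lam f a (n + 1) x = GG ξ lam f a n x := by
        intro x
        unfold GG Sm
        rw [Finset.sum_range_succ _ (n + 1), han]; simp
      simp only [this, han, add_zero]
      exact ih
    · have hn : h ≤ n := by
        by_contra hc
        have := ha0 (n + 1) (by omega)
        rw [han] at this; norm_num at this
      have h1 := step H hξ hA hAB hl ha hh ha0 hlh hr hn han
      have hI : 0 ≤ ∫ x in A..B, GG ξ lam f a n x :=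
        intervalIntegral.integral_nonneg hAB' fun x _ => (GG_pos ξ lam f a n x).le
      rw [han, mul_add, mul_one, Real.exp_add, mul_comm (Real.exp _)]
      refine h1.trans ?_
      gcongr
      rw [add_comm]
      exact Real.add_one_le_exp _

structure Pre (f : ℝ → ℝ) (σ : ℝ) : Prop where
  meas : Measurable f
  per : ∀ x, f (x + 1) = f x
  mean : ∫ x in (0:ℝ)..1, f x = 0
  bd : ∀ x, |f x| ≤ 2
  l1 : ∫ x in (0:ℝ)..1, |f x| ≤ σ
  modu : ∀ u, 0 ≤ u → u ≤ 1 → ∫ x in (0:ℝ)..1, |f (x + u) - f x| ≤ 4 * u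

lemma per_int {f : ℝ → ℝ} (hp : ∀ x, f (x + 1) = f x) (k : ℤ) (x : ℝ) : f (x + k) = f x := by
  have : Function.Periodic f 1 := hp
  simpa using (this.int_mul k) x

lemma meas_ii {f : ℝ → ℝ} (hm : Measurable f) {K : ℝ} (hb : ∀ x, |f x| ≤ K) (a b : ℝ) :
    IntervalIntegrable f volume a b := by
  refine (intervalIntegrable_const (c := K)).mono_fun hm.aestronglyMeasurable ?_
  refine Eventually.of_forall fun x => ?_
  show |f x| ≤ |K|
  exact (hb x).trans (le_abs_self _)

lemma bv_var {f : ℝ → ℝ} (hp : ∀ x, f (x + 1) = f x)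
    (hv : eVariationOn f (Set.Icc (0:ℝ) 1) ≤ 2) (k : ℤ) (n : ℕ) :
    eVariationOn f (Set.Icc (k:ℝ) (k + n)) ≤ 2 * n := by
  have hI : Monotone (fun i : ℕ => (k:ℝ) + i) := by
    intro i j hij
    have : (i:ℝ) ≤ j := by exact_mod_cast hij
    simpa using this
  have := eVariationOn.sum' f hI (n := n)
  simp only [Nat.cast_zero, add_zero] at this
  rw [← this]
  calc _ ≤ ∑ i ∈ Finset.range n, (2:ENNReal) := by
        apply Finset.sum_le_sum
        intro i _
        refine le_trans ?_ hv
        have h := eVariationOn.comp_le_of_monotoneOn f (s := Set.Icc (0:ℝ) 1)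
          (t := Set.Icc ((k:ℝ) + i) (k + (i+1:ℕ))) (fun x => x - (k + i))
          (fun a _ b _ hab => by simpa using hab)
          (fun x hx => by
            have h1 := hx.1
            have h2 := hx.2
            push_cast at h2
            constructor <;> simp only [] <;> linarith)
        refine le_trans (le_of_eq ?_) h
        apply eVariationOn.congr
        intro x _
        have := per_int hp (k + i) (x - (k + i))
        simp only [Function.comp]
        rw [← this]
        push_cast
        ring_nf
    _ = 2 * n := by simp [mul_comm]

lemma bv_loc {f : ℝ → ℝ} (hp : ∀ x, f (x + 1) = f x)
    (hv : eVariationOn f (Set.Icc (0:ℝ) 1) ≤ 2) : LocallyBoundedVariationOn f Set.univ := by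
  intro a b _ _
  obtain ⟨n, hn⟩ := exists_nat_ge (b - ⌊a⌋)
  have h := bv_var hp hv ⌊a⌋ n
  have h2 : eVariationOn f (Set.univ ∩ Set.Icc a b) ≤ 2 * n := by
    refine le_trans (eVariationOn.mono f ?_) h
    rintro x ⟨_, hx1, hx2⟩
    exact ⟨(Int.floor_le a).trans hx1, by linarith⟩
  exact ne_top_of_le_ne_top (ENNReal.mul_ne_top (by simp) (by simp)) h2

lemma bv_meas {f : ℝ → ℝ} (hl : LocallyBoundedVariationOn f Set.univ) :
    Measurable f ∧ {x | ¬ ContinuousAt f x}.Countable := by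
  obtain ⟨p, q, hp, hq, rfl⟩ := hl.exists_monotoneOn_sub_monotoneOn
  rw [monotoneOn_univ] at hp hq
  refine ⟨hp.measurable.sub hq.measurable, ?_⟩
  refine (hp.countable_not_continuousAt.union hq.countable_not_continuousAt).mono ?_
  intro x hx
  by_contra hcon
  simp only [Set.mem_union, Set.mem_ofPred_eq, not_or, not_not] at hcon
  exact hx (hcon.1.sub hcon.2)

lemma bv_bd {f : ℝ → ℝ} (hp : ∀ x, f (x + 1) = f x) (h0 : ∫ x in (0:ℝ)..1, f x = 0)
    (hv : eVariationOn f (Set.Icc (0:ℝ) 1) ≤ 2) (x : ℝ) : |f x| ≤ 2 := by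
  have hb : ∀ x ∈ Set.Icc (0:ℝ) 1, ∀ y ∈ Set.Icc (0:ℝ) 1, |f x - f y| ≤ 2 := by
    intro x hx y hy
    have h := (eVariationOn.edist_le f hx hy).trans hv
    rw [edist_dist] at h
    have h2 := ENNReal.ofReal_le_ofNat.1 h
    simpa [Real.dist_eq] using h2
  have key : ∀ x ∈ Set.Icc (0:ℝ) 1, |f x| ≤ 2 := by
    intro x hx
    have hm := (bv_meas (bv_loc hp hv)).1
    have hii : IntervalIntegrable f volume 0 1 := by
      refine (intervalIntegrable_const (c := |f x| + 2)).mono_fun' hm.aestronglyMeasurable ?_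
      refine (ae_restrict_iff' measurableSet_uIoc).2 (Eventually.of_forall fun y hy => ?_)
      rw [Set.uIoc_of_le zero_le_one] at hy
      have := hb x hx y ⟨hy.1.le, hy.2⟩
      show |f y| ≤ |f x| + 2
      rw [abs_le] at this
      rw [abs_le]
      constructor <;> cases abs_cases (f x) <;> linarith
    have h1 : ∫ y in (0:ℝ)..1, (f x - f y) ≤ ∫ y in (0:ℝ)..1, (2:ℝ) := by
      apply intervalIntegral.integral_mono_on zero_le_one (intervalIntegrable_const.sub hii)
        intervalIntegrable_const
      intro y hy
      exact (le_abs_self _).trans (hb x hx y hy)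
    have h2 : ∫ y in (0:ℝ)..1, (-2:ℝ) ≤ ∫ y in (0:ℝ)..1, (f x - f y) := by
      apply intervalIntegral.integral_mono_on zero_le_one
        intervalIntegrable_const (intervalIntegrable_const.sub hii)
      intro y hy
      exact (abs_le.1 (hb x hx y hy)).1
    rw [intervalIntegral.integral_sub intervalIntegrable_const hii, h0] at h1 h2
    simp at h1 h2
    rw [abs_le]
    constructor <;> linarith
  have := per_int hp ⌊x⌋ (Int.fract x)
  rw [Int.fract_add_floor] at this
  rw [this]
  exact key _ ⟨Int.fract_nonneg x, (Int.fract_lt_one x).le⟩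

lemma bv_modu {f : ℝ → ℝ} (hp : ∀ x, f (x + 1) = f x)
    (hv : eVariationOn f (Set.Icc (0:ℝ) 1) ≤ 2) (hbd : ∀ x, |f x| ≤ 2) {u : ℝ} (hu : 0 ≤ u)
    (hu1 : u ≤ 1) :
    ∫ x in (0:ℝ)..1, |f (x + u) - f x| ≤ 4 * u := by
  have hl := bv_loc hp hv
  have hm := (bv_meas hl).1
  set V := variationOnFromTo f Set.univ 0 with hV
  have hVm : Monotone V := monotoneOn_univ.1 (variationOnFromTo.monotoneOn hl (Set.mem_univ _))
  have hVi : ∀ a b, IntervalIntegrable V volume a b := fun a b => hVm.intervalIntegrable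
  have hVi' : ∀ c a b, IntervalIntegrable (fun x => V (x + c)) volume a b := by
    intro c a b
    have : Monotone (fun x => V (x + c)) := fun x y h => hVm (by linarith)
    exact this.intervalIntegrable
  have h1 : ∫ x in (0:ℝ)..1, |f (x + u) - f x| ≤ ∫ x in (0:ℝ)..1, (V (x + u) - V x) := by
    apply intervalIntegral.integral_mono_on zero_le_one _ ((hVi' _ _ _).sub (hVi _ _))
    · intro x _
      exact variationOnFromTo.abs_sub_le_sub_of_le hl (Set.mem_univ _) (Set.mem_univ _)
        (Set.mem_univ _) (by linarith)
    · apply meas_ii (K := 4)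
      · exact ((hm.comp (measurable_id.add_const u)).sub hm).norm
      · intro x
        rw [abs_abs]
        have h3 := abs_le.1 (hbd x)
        have h4 := abs_le.1 (hbd (x+u))
        rw [abs_le]
        constructor <;> linarith
  have h2 : ∫ x in (0:ℝ)..1, (V (x + u) - V x) = ∫ x in (0:ℝ)..u, (V (x + 1) - V x) := by
    rw [intervalIntegral.integral_sub (hVi' _ _ _) (hVi _ _),
      intervalIntegral.integral_sub (hVi' _ _ _) (hVi _ _),
      intervalIntegral.integral_comp_add_right, intervalIntegral.integral_comp_add_right,
      intervalIntegral.integral_interval_sub_interval_comm (hVi _ _) (hVi _ _) (hVi _ _)]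
    simp only [zero_add]
    rw [intervalIntegral.integral_symm u 0, add_comm 1 u]
    rw [intervalIntegral.integral_symm (u+1) 1]
    ring
  have h3 : ∫ x in (0:ℝ)..u, (V (x + 1) - V x) ≤ ∫ x in (0:ℝ)..u, (4:ℝ) := by
    apply intervalIntegral.integral_mono_on hu ((hVi' _ _ _).sub (hVi _ _))
      intervalIntegrable_const
    intro x hx
    rw [hV, variationOnFromTo.sub_right hl (Set.mem_univ _) (Set.mem_univ _) (Set.mem_univ _),
      variationOnFromTo.eq_of_le _ _ (by linarith)]
    have h := bv_var hp hv 0 2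
    have h4 : eVariationOn f (Set.univ ∩ Set.Icc x (x+1)) ≤ ENNReal.ofReal 4 := by
      refine le_trans (eVariationOn.mono f ?_) (h.trans (le_of_eq ?_))
      · rintro y ⟨_, hy1, hy2⟩
        constructor
        · simpa using hx.1.trans hy1
        · push_cast
          linarith [hx.2]
      · norm_num
    exact ENNReal.toReal_le_of_le_ofReal (by norm_num) h4
  rw [h2] at h1
  refine h1.trans (h3.trans ?_)
  simp [mul_comm]

lemma shift_int {w : ℝ → ℝ} (hp : ∀ x, w (x + 1) = w x) (c : ℝ) :
    ∫ x in (0:ℝ)..1, w (x + c) = ∫ x in (0:ℝ)..1, w x := by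
  have h : Function.Periodic w 1 := hp
  rw [intervalIntegral.integral_comp_add_right]
  have := h.intervalIntegral_add_eq c 0
  rw [zero_add, add_comm 1 c, this, zero_add]

lemma unc_int {k : ℝ → ℝ → ℝ} (hm : Measurable (Function.uncurry k)) {K : ℝ}
    (hb : ∀ x t, |k x t| ≤ K) :
    IntegrableOn (Function.uncurry k) (Set.uIoc (0:ℝ) 1 ×ˢ Set.uIoc (0:ℝ) 1) := by
  refine Measure.integrableOn_of_bounded (M := K) ?_ hm.aestronglyMeasurable ?_
  · rw [Measure.volume_eq_prod, Measure.prod_prod]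
    simp
  · exact Eventually.of_forall fun z => hb z.1 z.2

lemma fub {k : ℝ → ℝ → ℝ} (hm : Measurable (Function.uncurry k)) {K c : ℝ}
    (hb : ∀ x t, |k x t| ≤ K)
    (hc : ∀ t ∈ Set.Icc (0:ℝ) 1, ∫ x in (0:ℝ)..1, |k x t| ≤ c) :
    ∫ x in (0:ℝ)..1, |∫ t in (0:ℝ)..1, k x t| ≤ c := by
  have hb' : ∀ x t, |(|k x t|)| ≤ K := fun x t => by rw [abs_abs]; exact hb x t
  have hm' : Measurable (Function.uncurry fun x t => |k x t|) := hm.norm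
  have hI : ∀ g : ℝ → ℝ → ℝ, Measurable (Function.uncurry g) →
      Measurable (fun x => ∫ t in (0:ℝ)..1, g x t) := by
    intro g hg
    simp_rw [intervalIntegral.integral_of_le (zero_le_one (α := ℝ))]
    exact (hg.stronglyMeasurable.integral_prod_right (ν := volume.restrict (Set.Ioc (0:ℝ) 1))).measurable
  have hB : ∀ g : ℝ → ℝ → ℝ, (∀ x t, |g x t| ≤ K) → ∀ x, |∫ t in (0:ℝ)..1, g x t| ≤ K := by
    intro g hg x
    have := intervalIntegral.norm_integral_le_of_norm_le_const (a := (0:ℝ)) (b := 1) (C := K)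
      (f := g x) (fun t _ => hg x t)
    simpa using this
  calc ∫ x in (0:ℝ)..1, |∫ t in (0:ℝ)..1, k x t|
      ≤ ∫ x in (0:ℝ)..1, ∫ t in (0:ℝ)..1, |k x t| := by
        apply intervalIntegral.integral_mono_on zero_le_one
        · exact meas_ii (hI k hm).norm (K := K) (fun x => by rw [Real.norm_eq_abs, abs_abs]; exact hB k hb x) _ _
        · exact meas_ii (hI _ hm') (hB _ hb') _ _
        · intro x _
          exact intervalIntegral.abs_integral_le_integral_abs zero_le_one
    _ = ∫ t in (0:ℝ)..1, ∫ x in (0:ℝ)..1, |k x t| :=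
        intervalIntegral_intervalIntegral_swap (unc_int hm' hb')
    _ ≤ ∫ t in (0:ℝ)..1, c := by
        have hm2 : Measurable (Function.uncurry fun t x => |k x t|) := hm'.comp measurable_swap
        apply intervalIntegral.integral_mono_on zero_le_one
        · exact meas_ii (hI _ hm2) (hB _ fun x t => hb' t x) _ _
        · exact intervalIntegrable_const
        · exact hc
    _ = c := by simp

noncomputable def Tu (u : ℝ) (f : ℝ → ℝ) (x : ℝ) : ℝ := ∫ t in (0:ℝ)..1, f (x + u * t)

lemma Pre.ii {f : ℝ → ℝ} {σ : ℝ} (H : Pre f σ) (a b : ℝ) : IntervalIntegrable f volume a b :=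
  meas_ii H.meas H.bd a b

lemma Pre.iit {f : ℝ → ℝ} {σ : ℝ} (H : Pre f σ) (u x a b : ℝ) :
    IntervalIntegrable (fun t => f (x + u * t)) volume a b :=
  meas_ii (H.meas.comp (by fun_prop)) (fun _ => H.bd _) a b

lemma Tu_eq {f : ℝ → ℝ} {σ : ℝ} (H : Pre f σ) {u : ℝ} (hu : 0 < u) (x : ℝ) :
    Tu u f x = u⁻¹ * ((∫ t in (0:ℝ)..(x+u), f t) - ∫ t in (0:ℝ)..x, f t) := by
  unfold Tu
  rw [intervalIntegral.integral_comp_add_mul _ hu.ne',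
    intervalIntegral.integral_interval_sub_left (H.ii _ _) (H.ii _ _)]
  simp

lemma Tu_cont {f : ℝ → ℝ} {σ : ℝ} (H : Pre f σ) {u : ℝ} (hu : 0 < u) : Continuous (Tu u f) := by
  have h := intervalIntegral.continuous_primitive H.ii 0
  have : Tu u f = fun x => u⁻¹ * ((∫ t in (0:ℝ)..(x+u), f t) - ∫ t in (0:ℝ)..x, f t) := by
    funext x
    exact Tu_eq H hu x
  rw [this]
  exact continuous_const.mul ((h.comp (continuous_id.add continuous_const)).sub h)

lemma Tu_deriv {f : ℝ → ℝ} {σ : ℝ} (H : Pre f σ) (hc : Continuous f) {u : ℝ} (hu : 0 < u) (x : ℝ) :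
    HasDerivAt (Tu u f) (u⁻¹ * (f (x + u) - f x)) x := by
  have : Tu u f = fun x => u⁻¹ * ((∫ t in (0:ℝ)..(x+u), f t) - ∫ t in (0:ℝ)..x, f t) := by
    funext x
    exact Tu_eq H hu x
  rw [this]
  have h1 : ∀ y, HasDerivAt (fun y => ∫ t in (0:ℝ)..y, f t) (f y) y := fun y =>
    intervalIntegral.integral_hasDerivAt_right (H.ii _ _)
      (hc.stronglyMeasurableAtFilter _ _) hc.continuousAt
  exact (((h1 (x+u)).comp_add_const x u).sub (h1 x)).const_mul _

lemma Tu_meas {f : ℝ → ℝ} (hm : Measurable f) (u : ℝ) :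
    Measurable (Function.uncurry fun x t => f (x + u * t)) :=
  hm.comp (by fun_prop)

lemma Tu_pre {f : ℝ → ℝ} {σ : ℝ} (H : Pre f σ) {u : ℝ} (hu : 0 < u) : Pre (Tu u f) σ := by
  refine ⟨(Tu_cont H hu).measurable, ?_, ?_, ?_, ?_, ?_⟩
  · intro x
    unfold Tu
    congr 1
    funext t
    rw [← H.per (x + u * t)]
    ring_nf
  · unfold Tu
    rw [intervalIntegral_intervalIntegral_swap (unc_int (Tu_meas H.meas u) fun x t => H.bd _)]
    simp only [shift_int H.per, H.mean]
    simp
  · intro x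
    unfold Tu
    have := intervalIntegral.norm_integral_le_of_norm_le_const (a := (0:ℝ)) (b := 1) (C := 2)
      (f := fun t => f (x + u * t)) (fun t _ => H.bd _)
    simpa using this
  · apply fub (Tu_meas H.meas u) (fun x t => H.bd _)
    intro t _
    rw [shift_int (w := fun x => |f x|) (fun x => by rw [H.per])]
    exact H.l1
  · intro v hv hv1
    have h1 : ∀ x, Tu u f (x + v) - Tu u f x = ∫ t in (0:ℝ)..1, (f (x + v + u * t) - f (x + u * t)) := by
      intro x
      exact (intervalIntegral.integral_sub (H.iit _ _ _ _) (H.iit _ _ _ _)).symm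
    simp only [h1]
    refine fub (K := 4) ?_ ?_ ?_
    · exact (H.meas.comp (by fun_prop : Measurable fun z : ℝ × ℝ => z.1 + v + u * z.2)).sub
        (Tu_meas H.meas u)
    · intro x t
      have h3 := abs_le.1 (H.bd (x + v + u * t))
      have h4 := abs_le.1 (H.bd (x + u * t))
      rw [abs_le]
      constructor <;> linarith
    · intro t _
      have h2 := shift_int (w := fun x => |f (x + v) - f x|) (fun x => by
        rw [H.per, add_right_comm, H.per]) (u * t)
      have h3 : (fun x => |f (x + v + u * t) - f (x + u * t)|) =
          fun x => |f (x + u * t + v) - f (x + u * t)| := by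
        funext x
        rw [add_right_comm]
      rw [h3, h2]
      exact H.modu v hv hv1

lemma Tu_err {f : ℝ → ℝ} {σ : ℝ} (H : Pre f σ) {u : ℝ} (hu : 0 < u) (hu1 : u ≤ 1) :
    ∫ x in (0:ℝ)..1, |Tu u f x - f x| ≤ 4 * u := by
  have h1 : ∀ x, Tu u f x - f x = ∫ t in (0:ℝ)..1, (f (x + u * t) - f x) := by
    intro x
    rw [intervalIntegral.integral_sub (H.iit _ _ _ _) intervalIntegrable_const]
    simp [Tu]
  simp only [h1]
  refine fub (K := 4) ?_ ?_ ?_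
  · exact (Tu_meas H.meas u).sub (H.meas.comp measurable_fst)
  · intro x t
    have h3 := abs_le.1 (H.bd (x + u * t))
    have h4 := abs_le.1 (H.bd x)
    rw [abs_le]
    constructor <;> linarith
  · intro t ht
    refine (H.modu (u * t) (mul_nonneg hu.le ht.1) ?_).trans ?_
    · nlinarith [ht.1, ht.2]
    · nlinarith [ht.1, ht.2]

lemma smooth {f : ℝ → ℝ} {σ : ℝ} (H : Pre f σ)
    {u : ℝ} (hu : 0 < u) (hu1 : u ≤ 1) :
    ∃ g g' : ℝ → ℝ, Good g g' (4 / u) σ ∧ ∫ x in (0:ℝ)..1, |f x - g x| ≤ 8 * u := by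
  have H1 := Tu_pre H hu
  have c1 := Tu_cont H hu
  have H2 := Tu_pre H1 hu
  have c2 := Tu_cont H1 hu
  refine ⟨Tu u (Tu u f), fun x => u⁻¹ * (Tu u f (x + u) - Tu u f x), ?_, ?_⟩
  · refine ⟨Tu_deriv H1 c1 hu, by fun_prop, H2.per, ?_, H2.mean, H2.bd, ?_, H2.l1, ?_⟩
    · intro x
      rw [H1.per, add_right_comm, H1.per]
    · intro x
      rw [abs_mul, abs_of_pos (inv_pos.2 hu), div_eq_inv_mul]
      apply mul_le_mul_of_nonneg_left _ (inv_pos.2 hu).le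
      have h3 := abs_le.1 (H1.bd (x + u))
      have h4 := abs_le.1 (H1.bd x)
      rw [abs_le]
      constructor <;> linarith
    · simp only [abs_mul, abs_of_pos (inv_pos.2 hu)]
      rw [intervalIntegral.integral_const_mul, inv_mul_le_iff₀ hu, mul_comm u]
      exact H1.modu u hu.le hu1
  · have e1 := Tu_err H hu hu1
    have e2 := Tu_err H1 hu hu1
    have i1 : IntervalIntegrable (fun x => |Tu u f x - f x|) volume 0 1 :=
      ((H1.ii 0 1).sub (H.ii 0 1)).abs
    have i2 : IntervalIntegrable (fun x => |Tu u (Tu u f) x - Tu u f x|) volume 0 1 :=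
      ((H2.ii 0 1).sub (H1.ii 0 1)).abs
    calc _ ≤ ∫ x in (0:ℝ)..1, (|Tu u f x - f x| + |Tu u (Tu u f) x - Tu u f x|) := by
          apply intervalIntegral.integral_mono_on zero_le_one ((H.ii 0 1).sub (H2.ii 0 1)).abs
            (i1.add i2)
          intro x _
          rw [abs_sub_comm]
          refine (abs_sub_le _ (Tu u f x) _).trans ?_
          linarith
      _ ≤ 8 * u := by
          rw [intervalIntegral.integral_add i1 i2]
          linarith

lemma rlem {w : ℝ → ℝ} {ξ A B K m : ℝ} (hξ : 0 < ξ) (hA : 1 < A) (hAB : B - A = 1)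
    (hm : Measurable w) (hp : ∀ x, w (x + 1) = w x) (hw0 : ∀ x, 0 ≤ w x) (hK : ∀ x, |w x| ≤ K)
    (hS : {x | ¬ ContinuousAt w x}.Countable) (hI : ∫ x in (0:ℝ)..1, w x ≤ m) {n : ℕ} (hn : 1 ≤ n) :
    ∫ x in A..B, w (ξ * x ^ n) ≤ m * (1 + 6 / ξ) := by
  have hii := meas_ii hm hK
  set m0 := ∫ x in (0:ℝ)..1, w x with hm0
  have m0n : 0 ≤ m0 := intervalIntegral.integral_nonneg zero_le_one fun x _ => hw0 x
  have hiv : ∀ a b, IntervalIntegrable (fun x => w x - m0) volume a b := fun a b =>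
    (hii a b).sub intervalIntegrable_const
  have hPhi : IntervalIntegrable (fun x => w (ξ * x ^ n) - m0) volume A B := by
    refine IntervalIntegrable.sub ?_ intervalIntegrable_const
    exact meas_ii (hm.comp (by fun_prop : Measurable fun x : ℝ => ξ * x ^ n)) (fun _ => hK _) _ _
  have hPhi' : IntervalIntegrable (fun x => w (ξ * x ^ n)) volume A B :=
    meas_ii (hm.comp (by fun_prop : Measurable fun x : ℝ => ξ * x ^ n)) (fun _ => hK _) _ _
  have hW := ibp (g := fun _ => 1) (g' := fun _ => 0) (w := fun y => w y - m0)
    (W := fun y => ∫ x in (0:ℝ)..y, (w x - m0)) (Ω := 2 * m0) hξ hA (by linarith : A ≤ B) hn hS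
    (fun x => hasDerivAt_const x 1) continuous_const (fun _ => zero_le_one)
    (intervalIntegral.continuous_primitive hiv 0)
    (fun y hy => by
      have hc : ContinuousAt w y := by simpa using hy
      exact intervalIntegral.integral_hasDerivAt_right (hiv _ _)
        ((hm.sub_const m0).stronglyMeasurable.stronglyMeasurableAtFilter) (hc.sub continuousAt_const))
    (fun y => pw (fun x => by rw [hp]) hiv (by
        rw [intervalIntegral.integral_sub (hii _ _) intervalIntegrable_const, ← hm0]; simp) (by
        calc _ ≤ ∫ x in (0:ℝ)..1, (w x + m0) := by
              apply intervalIntegral.integral_mono_on zero_le_one (hiv 0 1).abs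
                ((hii 0 1).add intervalIntegrable_const)
              intro x _
              have := hw0 x
              rw [abs_le]
              constructor <;> linarith
          _ = 2 * m0 := by
              rw [intervalIntegral.integral_add (hii _ _) intervalIntegrable_const, ← hm0]
              simp
              ring) y)
    hPhi
  have e1 : ∫ x in A..B, (1:ℝ) * (w (ξ * x ^ n) - m0) = (∫ x in A..B, w (ξ * x ^ n)) - m0 := by
    simp only [one_mul]
    rw [intervalIntegral.integral_sub hPhi' intervalIntegrable_const]
    simp [hAB]
  rw [e1] at hW
  have inv1 : ∀ x, 1 ≤ x → ∀ k : ℕ, (ξ * (n * x ^ k))⁻¹ ≤ ξ⁻¹ := by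
    intro x hx k
    apply inv_anti₀ hξ
    have h1 : (1:ℝ) ≤ n := by exact_mod_cast hn
    have h2 : 1 ≤ x ^ k := one_le_pow₀ hx
    have : 1 ≤ n * x ^ k := by nlinarith
    nlinarith
  have inv2 : ∀ x, 1 ≤ x → (ξ * x ^ n)⁻¹ ≤ ξ⁻¹ := by
    intro x hx
    apply inv_anti₀ hξ
    have h2 : 1 ≤ x ^ n := one_le_pow₀ hx
    nlinarith
  have i3 : ∫ x in A..B, (|(0:ℝ)| * (ξ * (n * x ^ (n-1)))⁻¹ + 1 * (ξ * x ^ n)⁻¹) ≤ ξ⁻¹ := by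
    have : ∫ x in A..B, (|(0:ℝ)| * (ξ * (n * x ^ (n-1)))⁻¹ + 1 * (ξ * x ^ n)⁻¹) ≤
        ∫ x in A..B, ξ⁻¹ := by
      apply intervalIntegral.integral_mono_on (by linarith)
      · simp only [abs_zero, zero_mul, zero_add, one_mul]
        apply ContinuousOn.intervalIntegrable
        apply ContinuousOn.inv₀ (by fun_prop)
        intro x hx
        rw [Set.uIcc_of_le (by linarith)] at hx
        have : 0 < x := by linarith [hx.1]
        positivity
      · exact intervalIntegrable_const
      · intro x hx
        simp only [abs_zero, zero_mul, zero_add, one_mul]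
        exact inv2 x (by linarith [hx.1])
    simpa [hAB] using this
  have hA1 := inv1 A hA.le (n-1)
  have hB1 := inv1 B (by linarith) (n-1)
  have : (∫ x in A..B, w (ξ * x ^ n)) - m0 ≤ 2 * m0 * (3 * ξ⁻¹) := by
    refine (le_abs_self _).trans (hW.trans ?_)
    apply mul_le_mul_of_nonneg_left _ (by linarith)
    linarith
  have h6 : m0 * (1 + 6/ξ) ≤ m * (1 + 6 / ξ) := mul_le_mul_of_nonneg_right hI (by positivity)
  have : m0 * (1 + 6 / ξ) = m0 + 2 * m0 * (3 * ξ⁻¹) := by ring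
  linarith

lemma markov {A B ε : ℝ} (hAB : A ≤ B) {F : ℝ → ℝ} (hF : IntervalIntegrable F volume A B)
    (h0 : ∀ x, 0 ≤ F x) (hε : 0 < ε) {S : Set ℝ} (hS : ∀ x ∈ S, x ∈ Set.Icc A B ∧ ε ≤ F x) :
    (volume S).toReal ≤ (∫ x in A..B, F x) / ε := by
  have hi : Integrable F (volume.restrict (Set.Icc A B)) := by
    have := (intervalIntegrable_iff_integrableOn_Icc_of_le hAB).1 hF
    exact this
  have h1 := mul_meas_ge_le_integral_of_nonneg (Eventually.of_forall h0) hi ε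
  have e : ∫ x in A..B, F x = ∫ x, F x ∂(volume.restrict (Set.Icc A B)) := by
    rw [intervalIntegral.integral_of_le hAB, integral_Icc_eq_integral_Ioc]
  rw [e, le_div_iff₀ hε, mul_comm]
  refine le_trans (mul_le_mul_of_nonneg_left ?_ hε.le) h1
  rw [Measure.real]
  apply ENNReal.toReal_mono (measure_ne_top _ _)
  rw [Measure.restrict_apply' measurableSet_Icc]
  apply measure_mono
  intro x hx
  exact ⟨(hS x hx).2, (hS x hx).1⟩

lemma tail_R {f g g' : ℝ → ℝ} {σ D ξ A B m T : ℝ} (hξ : 0 < ξ) (hA : 1 < A) (hAB : B - A = 1)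
    (H : Pre f σ) (hS : {x | ¬ ContinuousAt f x}.Countable) (G : Good g g' D σ)
    (hm : ∫ x in (0:ℝ)..1, |f x - g x| ≤ m) (hT : 0 < T) (s : ℕ → ℕ) (M N : ℕ)
    (hs : ∀ n, 1 ≤ n → 1 ≤ s n) :
    (volume {x ∈ Set.Icc A B | T ≤ |∑ n ∈ Finset.Icc (M + 1) (M + N),
      (f (ξ * x ^ s n) - g (ξ * x ^ s n))|}).toReal ≤
      4 * N * (N * (m * (1 + 6 / ξ))) / T ^ 2 := by
  have hwm : Measurable (fun x => |f x - g x|) := (H.meas.sub G.cont.measurable).norm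
  have hw4 : ∀ x, |f x - g x| ≤ 4 := by
    intro x
    have h3 := abs_le.1 (H.bd x)
    have h4 := abs_le.1 (G.bd x)
    rw [abs_le]
    constructor <;> linarith
  have hr : ∀ n ∈ Finset.Icc (M + 1) (M + N),
      ∫ x in A..B, |f (ξ * x ^ s n) - g (ξ * x ^ s n)| ≤ m * (1 + 6 / ξ) := by
    intro n hn
    refine rlem (w := fun x => |f x - g x|) (K := 4) hξ hA hAB hwm ?_ (fun x => abs_nonneg _)
      ?_ ?_ hm (hs n (by have := (Finset.mem_Icc.1 hn).1; omega))
    · intro x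
      rw [H.per, G.per]
    · intro x
      rw [abs_abs]
      exact hw4 x
    · refine hS.mono ?_
      intro x hx hc
      exact hx ((ContinuousAt.sub hc G.cont.continuousAt).abs)
  have hii : ∀ n, IntervalIntegrable (fun x => |f (ξ * x ^ s n) - g (ξ * x ^ s n)|) volume A B := by
    intro n
    refine meas_ii (hwm.comp (by fun_prop : Measurable fun x : ℝ => ξ * x ^ s n)) (K := 4) ?_ _ _
    intro x
    simp only [Function.comp, abs_abs]
    exact hw4 _
  have hcard : (Finset.Icc (M + 1) (M + N)).card = N := by simp
  have hmk := markov (A := A) (B := B) (ε := T ^ 2)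
    (F := fun x => 4 * N * ∑ n ∈ Finset.Icc (M + 1) (M + N), |f (ξ * x ^ s n) - g (ξ * x ^ s n)|)
    (by linarith) (by
      apply IntervalIntegrable.const_mul
      have := IntervalIntegrable.sum (Finset.Icc (M + 1) (M + N))
        (f := fun n x => |f (ξ * x ^ s n) - g (ξ * x ^ s n)|) (fun n _ => hii n)
      simpa [Finset.sum_fn] using this)
    (fun x => by
      have : 0 ≤ ∑ n ∈ Finset.Icc (M + 1) (M + N), |f (ξ * x ^ s n) - g (ξ * x ^ s n)| :=
        Finset.sum_nonneg fun _ _ => abs_nonneg _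
      positivity) (by positivity)
    (S := {x ∈ Set.Icc A B | T ≤ |∑ n ∈ Finset.Icc (M + 1) (M + N),
      (f (ξ * x ^ s n) - g (ξ * x ^ s n))|}) (by
      rintro x ⟨hx, hx2⟩
      refine ⟨hx, ?_⟩
      have h1 : |∑ n ∈ Finset.Icc (M + 1) (M + N), (f (ξ * x ^ s n) - g (ξ * x ^ s n))| ≤
        ∑ n ∈ Finset.Icc (M + 1) (M + N), |f (ξ * x ^ s n) - g (ξ * x ^ s n)| :=
        Finset.abs_sum_le_sum_abs _ _
      have h2 : ∑ n ∈ Finset.Icc (M + 1) (M + N), |f (ξ * x ^ s n) - g (ξ * x ^ s n)| ≤ 4 * N := by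
        refine (Finset.sum_le_card_nsmul _ _ 4 fun n _ => hw4 _).trans (le_of_eq ?_)
        rw [hcard, nsmul_eq_mul, mul_comm]
      set Z := ∑ n ∈ Finset.Icc (M + 1) (M + N), |f (ξ * x ^ s n) - g (ξ * x ^ s n)|
      show T ^ 2 ≤ 4 * N * Z
      nlinarith)
  refine hmk.trans ?_
  apply div_le_div_of_nonneg_right _ (by positivity)
  rw [intervalIntegral.integral_const_mul]
  apply mul_le_mul_of_nonneg_left _ (by positivity)
  rw [intervalIntegral.integral_finsetSum fun n _ => hii n]
  refine (Finset.sum_le_card_nsmul _ _ _ hr).trans (le_of_eq ?_)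
  rw [hcard, nsmul_eq_mul]

lemma Good.neg {f f' : ℝ → ℝ} {D σ : ℝ} (H : Good f f' D σ) :
    Good (fun x => - f x) (fun x => - f' x) D σ := by
  refine ⟨fun y => (H.hd y).neg, H.hc.neg, fun x => by rw [H.per], fun x => by rw [H.per'], ?_,
    fun x => by rw [abs_neg]; exact H.bd x, fun x => by rw [abs_neg]; exact H.hD x, ?_, ?_⟩
  · rw [intervalIntegral.integral_neg, H.mean, neg_zero]
  · simp only [abs_neg]; exact H.l1
  · simp only [abs_neg]; exact H.var

lemma tail_one {f f' : ℝ → ℝ} {D σ ξ A B lam T : ℝ} {h : ℕ} (H : Good f f' D σ) (hξ : 0 < ξ)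
    (hA : 1 < A) (hAB : B - A = 1) (hl : 0 ≤ lam) (hh : 1 ≤ h) (hlh : 4 * lam * h ≤ 1)
    (hσ : 0 ≤ σ)
    (hr : (A⁻¹) ^ h * (3 * (lam * D * (1 - A⁻¹)⁻¹) + 5 / ξ) ≤ lam)
    (s : ℕ → ℕ) (hs : StrictMono s) (M N : ℕ) :
    (volume {x ∈ Set.Icc A B | T ≤ ∑ n ∈ Finset.Icc (M + 1) (M + N), f (ξ * x ^ s n)}).toReal ≤
      Real.exp (1 + (74 + 108 * (1 - A⁻¹)⁻¹) * lam ^ 2 * σ * N - lam * T) := by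
  classical
  set I := (Finset.Icc (M + 1) (M + N)).image s with hI
  set a : ℕ → ℝ := fun k => if k ∈ I ∧ h < k then 1 else 0 with ha
  have hA' : A⁻¹ < 1 := inv_lt_one_of_one_lt₀ hA
  have hcard : I.card = N := by
    rw [hI, Finset.card_image_of_injective _ hs.injective]; simp
  have hE := exp_moment (a := a) H hξ hA hAB hl (fun k => by
      simp only [ha]; split_ifs <;> simp) hh (fun k hk => by
      simp only [ha]; rw [if_neg]; omega) hlh hr (s (M + N))
  have hIr : I ⊆ Finset.range (s (M + N) + 1) := by
    intro k hk
    obtain ⟨n, hn, rfl⟩ := Finset.mem_image.1 hk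
    rw [Finset.mem_range]
    have := hs.monotone (Finset.mem_Icc.1 hn).2
    omega
  have hfil : (Finset.range (s (M + N) + 1)).filter (fun k => k ∈ I ∧ h < k) =
      I.filter (fun k => h < k) := by
    ext k
    simp only [Finset.mem_filter]
    constructor
    · rintro ⟨_, h1, h2⟩; exact ⟨h1, h2⟩
    · rintro ⟨h1, h2⟩; exact ⟨hIr h1, h1, h2⟩
  have hsuma : ∑ k ∈ Finset.range (s (M + N) + 1), a k ≤ N := by
    simp only [ha]
    rw [← Finset.sum_filter, hfil, Finset.sum_const, nsmul_eq_mul, mul_one]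
    have := Finset.card_filter_le I (fun k => h < k)
    rw [hcard] at this
    exact_mod_cast this
  have hSm : ∀ x, ∑ n ∈ Finset.Icc (M + 1) (M + N), f (ξ * x ^ s n) ≤
      Sm ξ f a (s (M + N)) x + 2 * (h + 1) := by
    intro x
    have e1 : ∑ n ∈ Finset.Icc (M + 1) (M + N), f (ξ * x ^ s n) = ∑ k ∈ I, f (ξ * x ^ k) := by
      rw [hI, Finset.sum_image fun i _ j _ hij => hs.injective hij]
    have e2 : Sm ξ f a (s (M + N)) x = ∑ k ∈ I.filter (fun k => h < k), f (ξ * x ^ k) := by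
      unfold Sm
      simp only [ha, ite_mul, one_mul, zero_mul]
      rw [← Finset.sum_filter, hfil]
    rw [e1, e2, ← Finset.sum_filter_add_sum_filter_not I (fun k => h < k)]
    have e3 : ∑ k ∈ I.filter (fun k => ¬ h < k), f (ξ * x ^ k) ≤ 2 * (h + 1) := by
      refine (Finset.sum_le_card_nsmul _ _ 2 fun k _ => (le_abs_self _).trans (H.bd _)).trans ?_
      rw [nsmul_eq_mul, mul_comm]
      have : (I.filter (fun k => ¬ h < k)).card ≤ h + 1 := by
        refine (Finset.card_le_card (t := Finset.range (h + 1)) ?_).trans (by simp)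
        intro k hk
        have := (Finset.mem_filter.1 hk).2
        rw [Finset.mem_range]
        omega
      have : ((I.filter (fun k => ¬ h < k)).card : ℝ) ≤ h + 1 := by exact_mod_cast this
      linarith
    linarith
  have hmk := markov (A := A) (B := B) (ε := Real.exp (lam * T - 1)) (F := GG ξ lam f a (s (M + N)))
    (by linarith) ((GG_cont H ξ lam a _).intervalIntegrable _ _) (fun x => (GG_pos _ _ _ _ _ _).le)
    (Real.exp_pos _)
    (S := {x ∈ Set.Icc A B | T ≤ ∑ n ∈ Finset.Icc (M + 1) (M + N), f (ξ * x ^ s n)}) (by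
      rintro x ⟨hx, hx2⟩
      refine ⟨hx, ?_⟩
      unfold GG
      apply Real.exp_le_exp.2
      have h1 := hSm x
      have h2 : lam * T ≤ lam * (Sm ξ f a (s (M + N)) x + 2 * (h + 1)) :=
        mul_le_mul_of_nonneg_left (hx2.trans h1) hl
      have h3 : (1:ℝ) ≤ h := by exact_mod_cast hh
      nlinarith)
  refine hmk.trans ?_
  rw [div_le_iff₀ (Real.exp_pos _), ← Real.exp_add]
  refine hE.trans (Real.exp_le_exp.2 ?_)
  have hk : 0 ≤ (74 + 108 * (1 - A⁻¹)⁻¹) * lam ^ 2 * σ := by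
    have : 0 < (1 - A⁻¹)⁻¹ := inv_pos.2 (by linarith)
    positivity
  have := mul_le_mul_of_nonneg_left hsuma hk
  linarith

lemma tail_g {f f' : ℝ → ℝ} {D σ ξ A B lam T : ℝ} {h : ℕ} (H : Good f f' D σ) (hξ : 0 < ξ)
    (hA : 1 < A) (hAB : B - A = 1) (hl : 0 ≤ lam) (hh : 1 ≤ h) (hlh : 4 * lam * h ≤ 1)
    (hσ : 0 ≤ σ)
    (hr : (A⁻¹) ^ h * (3 * (lam * D * (1 - A⁻¹)⁻¹) + 5 / ξ) ≤ lam)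
    (s : ℕ → ℕ) (hs : StrictMono s) (M N : ℕ) :
    (volume {x ∈ Set.Icc A B | T ≤ |∑ n ∈ Finset.Icc (M + 1) (M + N), f (ξ * x ^ s n)|}).toReal ≤
      2 * Real.exp (1 + (74 + 108 * (1 - A⁻¹)⁻¹) * lam ^ 2 * σ * N - lam * T) := by
  have h1 := tail_one (T := T) H hξ hA hAB hl hh hlh hσ hr s hs M N
  have h2 := tail_one (T := T) H.neg hξ hA hAB hl hh hlh hσ hr s hs M N
  set S1 := {x ∈ Set.Icc A B | T ≤ ∑ n ∈ Finset.Icc (M + 1) (M + N), f (ξ * x ^ s n)}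
  set S2 := {x ∈ Set.Icc A B | T ≤ ∑ n ∈ Finset.Icc (M + 1) (M + N), - f (ξ * x ^ s n)}
  have f1 : volume S1 ≠ ⊤ := measure_ne_top_of_subset (fun x hx => hx.1 : S1 ⊆ Set.Icc A B) (by simp)
  have f2 : volume S2 ≠ ⊤ := measure_ne_top_of_subset (fun x hx => hx.1 : S2 ⊆ Set.Icc A B) (by simp)
  have h3 : {x ∈ Set.Icc A B | T ≤ |∑ n ∈ Finset.Icc (M + 1) (M + N), f (ξ * x ^ s n)|} ⊆ S1 ∪ S2 := by
    rintro x ⟨hx, hx2⟩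
    rcases le_abs.1 hx2 with h | h
    · exact Or.inl ⟨hx, h⟩
    · refine Or.inr ⟨hx, ?_⟩
      rw [Finset.sum_neg_distrib]
      exact h
  calc _ ≤ (volume S1 + volume S2).toReal :=
        ENNReal.toReal_mono (ENNReal.add_ne_top.2 ⟨f1, f2⟩)
          ((measure_mono h3).trans (measure_union_le _ _))
    _ = (volume S1).toReal + (volume S2).toReal := ENNReal.toReal_add f1 f2
    _ ≤ _ := by linarith

lemma plog_one (x : ℝ) : 1 ≤ plog x := le_max_left _ _

lemma aux_alg {x lam ρ : ℝ} (hx : 0 < x) :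
    (x ^ 20)⁻¹ * (3 * (lam * (4 / (x ^ 18)⁻¹) * ρ)) = lam / 2 * (24 * ρ / x ^ 2) := by
  rw [div_inv_eq_mul]
  have : (x ^ 20)⁻¹ * x ^ 18 = (x ^ 2)⁻¹ := by
    rw [show x ^ 20 = x ^ 2 * x ^ 18 by ring, mul_inv, mul_assoc, inv_mul_cancel₀ (by positivity),
      mul_one]
  calc _ = ((x ^ 20)⁻¹ * x ^ 18) * (12 * lam * ρ) := by ring
    _ = _ := by rw [this]; ring

set_option maxHeartbeats 1000000 in
lemma params {ξ A c ρ : ℝ} (hξ : 0 < ξ) (hA : 1 < A) (hc : 1 ≤ c) (hρ : 0 ≤ ρ) :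
    ∃ N₀ : ℕ, ∀ N : ℕ, N₀ ≤ N → 2 ≤ N ∧ ∀ σ : ℝ, σ ≤ 2 → (N:ℝ) ^ (-(1/4) : ℝ) / Real.sqrt 2 ≤ σ →
      ∃ h : ℕ, 1 ≤ h ∧
        4 * (σ ^ (-(3/4) : ℝ) * Real.sqrt (plog (plog N) / N) / c) * h ≤ 1 ∧
        (A⁻¹) ^ h * (3 * ((σ ^ (-(3/4) : ℝ) * Real.sqrt (plog (plog N) / N) / c)
          * (4 / ((N:ℝ) ^ 18)⁻¹) * ρ) + 5 / ξ)
          ≤ σ ^ (-(3/4) : ℝ) * Real.sqrt (plog (plog N) / N) / c := by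
  have hlA : 0 < Real.log A := Real.log_pos hA
  set κ := 160 / Real.log A + 16 with hκ
  have hκ0 : 0 < κ := by positivity
  have ev1 : ∀ᶠ N : ℕ in atTop, (Real.log N) ^ (2:ℝ) * κ ≤ (N:ℝ) ^ (5/16 : ℝ) := by
    have h := (isLittleO_log_rpow_rpow_atTop (2:ℝ) (by norm_num : (0:ℝ) < 5/16)).bound
      (inv_pos.2 hκ0)
    have h' := tendsto_natCast_atTop_atTop (R := ℝ) |>.eventually h
    filter_upwards [h', eventually_ge_atTop 1] with N hN hN1
    have hN1' : (1:ℝ) ≤ N := by exact_mod_cast hN1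
    have p1 : 0 ≤ Real.log N := Real.log_nonneg hN1'
    rw [Real.norm_of_nonneg (by positivity), Real.norm_of_nonneg (by positivity)] at hN
    rw [inv_mul_eq_div, le_div_iff₀ hκ0] at hN
    exact hN
  obtain ⟨N1, hN1⟩ := eventually_atTop.1 ev1
  obtain ⟨N2, hN2⟩ := exists_nat_ge (20 * c / ξ)
  obtain ⟨N3, hN3⟩ := exists_nat_ge (24 * ρ)
  refine ⟨N1 + N2 + N3 + 3, fun N hN => ⟨by omega, fun σ hσ2 hσ => ?_⟩⟩
  have hN3' : (3:ℝ) ≤ N := by exact_mod_cast (by omega : 3 ≤ N)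
  have q1 := hN1 N (by omega)
  have q2 : 20 * c / ξ ≤ N := hN2.trans (by exact_mod_cast (by omega : N2 ≤ N))
  have q3 : 24 * ρ ≤ N := hN3.trans (by exact_mod_cast (by omega : N3 ≤ N))
  have hNp : (0:ℝ) < N := by linarith
  have hN1r : (1:ℝ) ≤ N := by linarith
  have hlog : 1 ≤ Real.log N := by
    rw [Real.le_log_iff_exp_le hNp]
    have := Real.exp_one_lt_d9
    linarith
  set l := Real.log N with hl
  set L := plog (plog N) with hL
  have hL1 : 1 ≤ L := plog_one _
  have hpl : plog N = l := max_eq_right hlog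
  have hLl : L ≤ l := by
    rw [hL, hpl]
    apply max_le hlog
    have := Real.log_le_sub_one_of_pos (by linarith : 0 < l)
    linarith
  have hs2 : 0 < Real.sqrt 2 := by positivity
  have hσ0 : 0 < σ := lt_of_lt_of_le (by positivity) hσ
  set lam := σ ^ (-(3/4) : ℝ) * Real.sqrt (L / N) / c with hlam
  -- lower bound
  have low : 1 / (2 * c * N) ≤ lam := by
    have a1 : (1/2:ℝ) ≤ σ ^ (-(3/4) : ℝ) := by
      calc (1/2:ℝ) = 2 ^ (-1:ℝ) := by rw [Real.rpow_neg_one]; norm_num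
        _ ≤ 2 ^ (-(3/4):ℝ) := Real.rpow_le_rpow_of_exponent_le (by norm_num) (by norm_num)
        _ ≤ σ ^ (-(3/4):ℝ) := Real.rpow_le_rpow_of_nonpos hσ0 hσ2 (by norm_num)
    have a2 : 1 / (N:ℝ) ≤ Real.sqrt (L / N) := by
      apply Real.le_sqrt_of_sq_le
      rw [div_pow, one_pow]
      apply div_le_div₀ (by linarith) hL1 hNp
      nlinarith
    rw [hlam, le_div_iff₀ (by linarith)]
    calc 1 / (2 * c * N) * c = (1/2) * (1 / N) := by field_simp
      _ ≤ _ := mul_le_mul a1 a2 (by positivity) (by positivity)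
  have lam0 : 0 < lam := lt_of_lt_of_le (by positivity) low
  have up : lam ≤ 2 * l * (N:ℝ) ^ (-(5/16) : ℝ) := by
    have a1 : σ ^ (-(3/4) : ℝ) ≤ 2 * (N:ℝ) ^ (3/16 : ℝ) := by
      calc σ ^ (-(3/4) : ℝ) ≤ ((N:ℝ) ^ (-(1/4) : ℝ) / Real.sqrt 2) ^ (-(3/4) : ℝ) :=
            Real.rpow_le_rpow_of_nonpos (by positivity) hσ (by norm_num)
        _ = (N:ℝ) ^ (3/16 : ℝ) * (Real.sqrt 2) ^ (3/4 : ℝ) := by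
            rw [Real.div_rpow (by positivity) (by positivity), ← Real.rpow_mul hNp.le,
              Real.rpow_neg hs2.le, div_inv_eq_mul]
            norm_num
        _ ≤ (N:ℝ) ^ (3/16 : ℝ) * 2 := by
            apply mul_le_mul_of_nonneg_left _ (by positivity)
            have b1 : 1 ≤ Real.sqrt 2 := Real.one_le_sqrt.2 (by norm_num)
            have b2 : Real.sqrt 2 ≤ 2 := by
              rw [Real.sqrt_le_left (by norm_num)]; norm_num
            calc (Real.sqrt 2) ^ (3/4 : ℝ) ≤ (Real.sqrt 2) ^ (1 : ℝ) :=
                  Real.rpow_le_rpow_of_exponent_le b1 (by norm_num)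
              _ ≤ 2 := by rw [Real.rpow_one]; exact b2
        _ = _ := mul_comm _ _
    have a2 : Real.sqrt (L / N) ≤ l * (N:ℝ) ^ (-(1/2) : ℝ) := by
      rw [Real.sqrt_div (by linarith), Real.rpow_neg hNp.le, ← Real.sqrt_eq_rpow, ← div_eq_mul_inv]
      apply div_le_div_of_nonneg_right _ (Real.sqrt_nonneg _)
      rw [Real.sqrt_le_left (by linarith)]
      nlinarith
    have a3 : σ ^ (-(3/4) : ℝ) * Real.sqrt (L / N) ≤ 2 * l * (N:ℝ) ^ (-(5/16) : ℝ) := by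
      calc _ ≤ (2 * (N:ℝ) ^ (3/16 : ℝ)) * (l * (N:ℝ) ^ (-(1/2) : ℝ)) :=
            mul_le_mul a1 a2 (Real.sqrt_nonneg _) (by positivity)
        _ = 2 * l * ((N:ℝ) ^ (3/16 : ℝ) * (N:ℝ) ^ (-(1/2) : ℝ)) := by ring
        _ = _ := by
            rw [← Real.rpow_add hNp]
            norm_num
    refine le_trans ?_ a3
    rw [hlam]
    exact div_le_self (by positivity) hc
  set h := ⌈20 * l / Real.log A⌉₊ + 1 with hh
  have hge : 20 * l / Real.log A ≤ h := by
    rw [hh]; push_cast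
    linarith [Nat.le_ceil (20 * l / Real.log A)]
  have hle : (h:ℝ) ≤ 20 * l / Real.log A + 2 := by
    rw [hh]; push_cast
    have := Nat.ceil_lt_add_one (by positivity : 0 ≤ 20 * l / Real.log A)
    linarith
  refine ⟨h, by omega, ?_, ?_⟩
  · have c1 : (h:ℝ) ≤ (20 / Real.log A + 2) * l := by
      refine hle.trans ?_
      have : 20 * l / Real.log A = 20 / Real.log A * l := by ring
      nlinarith
    have hκ' : 8 * (20 / Real.log A + 2) = κ := by rw [hκ]; ring
    calc 4 * lam * h ≤ 4 * (2 * l * (N:ℝ) ^ (-(5/16) : ℝ)) * ((20 / Real.log A + 2) * l) := by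
          apply mul_le_mul _ c1 (by positivity) (by positivity)
          linarith
      _ = (l ^ (2:ℝ) * κ) * (N:ℝ) ^ (-(5/16) : ℝ) := by
          rw [← hκ', Real.rpow_two]; ring
      _ ≤ (N:ℝ) ^ (5/16 : ℝ) * (N:ℝ) ^ (-(5/16) : ℝ) :=
          mul_le_mul_of_nonneg_right q1 (by positivity)
      _ = 1 := by
          rw [← Real.rpow_add hNp]
          norm_num
  · have d1 : (A⁻¹) ^ h ≤ ((N:ℝ) ^ 20)⁻¹ := by
      rw [inv_pow]
      apply inv_anti₀ (by positivity)
      rw [div_le_iff₀ hlA] at hge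
      have : Real.log ((N:ℝ) ^ 20) ≤ Real.log (A ^ h) := by
        rw [Real.log_pow, Real.log_pow]
        push_cast
        exact hge
      exact (Real.log_le_log_iff (by positivity) (by positivity)).1 this
    have d2 : ((N:ℝ) ^ 20)⁻¹ * (3 * (lam * (4 / ((N:ℝ) ^ 18)⁻¹) * ρ)) ≤ lam / 2 := by
      rw [aux_alg hNp]
      apply mul_le_of_le_one_right (by positivity)
      rw [div_le_one (by positivity)]
      nlinarith
    have d3 : ((N:ℝ) ^ 20)⁻¹ * (5 / ξ) ≤ lam / 2 := by
      have : ((N:ℝ) ^ 20)⁻¹ * (5 / ξ) ≤ 1 / (2 * c * N) / 2 := by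
        rw [div_le_iff₀ hξ] at q2
        rw [div_div, inv_mul_eq_div, div_div, div_le_div_iff₀ (by positivity) (by positivity)]
        have e1 : (N:ℝ) ^ 2 ≤ N ^ 20 := pow_le_pow_right₀ hN1r (by norm_num)
        have e2 : 5 * (2 * c * N * 2) ≤ N * ξ * N := by nlinarith
        nlinarith
      linarith
    calc _ ≤ ((N:ℝ) ^ 20)⁻¹ * (3 * (lam * (4 / ((N:ℝ) ^ 18)⁻¹) * ρ) + 5 / ξ) :=
          mul_le_mul_of_nonneg_right d1 (by positivity)
      _ ≤ lam := by rw [mul_add]; linarith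

lemma fnorm_facts {A B : ℝ} (hAB : B - A = 1) {f : ℝ → ℝ} (hm : Measurable f)
    (hp : ∀ x, f (x + 1) = f x) (hbd : ∀ x, |f x| ≤ 2) (hpos : 0 < fnorm A B f) :
    fnorm A B f ≤ 2 ∧ ∫ x in (0:ℝ)..1, |f x| ≤ fnorm A B f := by
  have hB : B = A + 1 := by linarith
  have hp2 : Function.Periodic (fun x => f x ^ 2) 1 := fun x => by simp only [hp]
  have e : ∫ x in A..B, f x ^ 2 = ∫ x in (0:ℝ)..1, f x ^ 2 := by
    have := hp2.intervalIntegral_add_eq A 0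
    rw [hB, this, zero_add]
  have hsq4 : ∀ x, f x ^ 2 ≤ 4 := by
    intro x
    have := abs_le.1 (hbd x)
    nlinarith
  have i2 : IntervalIntegrable (fun x => f x ^ 2) volume 0 1 :=
    meas_ii (K := 4) (hm.pow_const 2) (fun x => by rw [abs_of_nonneg (sq_nonneg _)]; exact hsq4 x) _ _
  have i1 : IntervalIntegrable (fun x => |f x|) volume 0 1 := (meas_ii hm hbd 0 1).abs
  have hsq : fnorm A B f ^ 2 = ∫ x in (0:ℝ)..1, f x ^ 2 := by
    unfold fnorm
    rw [Real.sq_sqrt, e]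
    rw [e]
    exact intervalIntegral.integral_nonneg zero_le_one fun x _ => sq_nonneg _
  set σ := fnorm A B f
  constructor
  · have : σ ^ 2 ≤ 4 := by
      rw [hsq]
      have := intervalIntegral.integral_mono_on zero_le_one i2
        (intervalIntegrable_const (c := (4:ℝ))) (fun x _ => hsq4 x)
      simpa using this
    nlinarith
  · have h : ∫ x in (0:ℝ)..1, (2 * σ) * |f x| ≤ ∫ x in (0:ℝ)..1, (f x ^ 2 + σ ^ 2) := by
      apply intervalIntegral.integral_mono_on zero_le_one (i1.const_mul _)
        (i2.add intervalIntegrable_const)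
      intro x _
      have := sq_nonneg (|f x| - σ)
      have := sq_abs (f x)
      nlinarith
    rw [intervalIntegral.integral_const_mul,
      intervalIntegral.integral_add i2 intervalIntegrable_const, ← hsq] at h
    simp at h
    have : (2 * σ) * ∫ x in (0:ℝ)..1, |f x| ≤ 2 * σ * σ := by nlinarith
    exact le_of_mul_le_mul_left this (by positivity)

lemma alg1 {σ L n c K δ : ℝ} (hσ : 0 < σ) (hL : 1 ≤ L) (hn : 0 < n) (hc : 0 < c) (hK : K ≤ c ^ 2) :
    1 + K * (σ ^ (-(3/4) : ℝ) * Real.sqrt (L / n) / c) ^ 2 * σ * n -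
      (σ ^ (-(3/4) : ℝ) * Real.sqrt (L / n) / c) * (δ * c * σ ^ ((1:ℝ)/4) * Real.sqrt (n * L) / 2)
      ≤ 1 + (1 - δ / 2) * σ ^ (-(1/2) : ℝ) * L := by
  have a1 : (σ ^ (-(3/4) : ℝ)) ^ 2 * σ = σ ^ (-(1/2) : ℝ) := by
    rw [pow_two, ← Real.rpow_add hσ, ← Real.rpow_add_one hσ.ne']
    norm_num
  have a2 : σ ^ (-(3/4) : ℝ) * σ ^ ((1:ℝ)/4) = σ ^ (-(1/2) : ℝ) := by
    rw [← Real.rpow_add hσ]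
    norm_num
  have a3 : Real.sqrt (L / n) ^ 2 = L / n := Real.sq_sqrt (by positivity)
  have a4 : Real.sqrt (L / n) * Real.sqrt (n * L) = L := by
    rw [← Real.sqrt_mul (by positivity)]
    have : L / n * (n * L) = L ^ 2 := by field_simp
    rw [this, Real.sqrt_sq (by linarith)]
  have b1 : K * (σ ^ (-(3/4) : ℝ) * Real.sqrt (L / n) / c) ^ 2 * σ * n =
      K / c ^ 2 * (σ ^ (-(1/2) : ℝ) * L) := by
    calc _ = K / c ^ 2 * (((σ ^ (-(3/4) : ℝ)) ^ 2 * σ) * (Real.sqrt (L / n) ^ 2 * n)) := by ring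
      _ = _ := by
        rw [a1, a3, div_mul_cancel₀ _ hn.ne']
  have b2 : (σ ^ (-(3/4) : ℝ) * Real.sqrt (L / n) / c) *
      (δ * c * σ ^ ((1:ℝ)/4) * Real.sqrt (n * L) / 2) = δ / 2 * (σ ^ (-(1/2) : ℝ) * L) := by
    calc _ = (c / c) * (δ / 2 * ((σ ^ (-(3/4) : ℝ) * σ ^ ((1:ℝ)/4)) *
          (Real.sqrt (L / n) * Real.sqrt (n * L)))) := by ring
      _ = _ := by rw [a2, a4, div_self hc.ne', one_mul]
  rw [b1, b2]
  have : K / c ^ 2 ≤ 1 := by rw [div_le_one (by positivity)]; exact hK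
  have p : 0 ≤ σ ^ (-(1/2) : ℝ) * L := by positivity
  nlinarith

lemma alg2 {σ L c δ : ℝ} {N : ℕ} (hN : 2 ≤ N) (hσ : (N:ℝ) ^ (-(1/4) : ℝ) / Real.sqrt 2 ≤ σ)
    (hL : 1 ≤ L) (hc : 1 ≤ c) (hδ : 0 < δ) :
    δ ^ 2 / 8 ≤ (δ * c * σ ^ ((1:ℝ)/4) * Real.sqrt (N * L) / 2) ^ 2 := by
  have hNr : (2:ℝ) ≤ N := by exact_mod_cast hN
  have hNp : (0:ℝ) < N := by linarith
  have hσ0 : 0 < σ := lt_of_lt_of_le (by positivity) hσ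
  have a1 : (σ ^ ((1:ℝ)/4)) ^ 2 = σ ^ ((1:ℝ)/2) := by
    rw [← Real.rpow_mul_natCast hσ0.le]
    norm_num
  have a2 : Real.sqrt (N * L) ^ 2 = N * L := Real.sq_sqrt (by positivity)
  have a3 : (1:ℝ) / 2 ≤ σ ^ ((1:ℝ)/2) * N := by
    rcases le_total 1 σ with h | h
    · have := Real.one_le_rpow h (by norm_num : (0:ℝ) ≤ 1/2)
      nlinarith
    · have h1 : σ ≤ σ ^ ((1:ℝ)/2) := by
        calc σ = σ ^ (1:ℝ) := (Real.rpow_one σ).symm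
          _ ≤ σ ^ ((1:ℝ)/2) := Real.rpow_le_rpow_of_exponent_ge hσ0 h (by norm_num)
      have h2 : (N:ℝ)⁻¹ ≤ (N:ℝ) ^ (-(1/4) : ℝ) := by
        rw [← Real.rpow_neg_one]
        exact Real.rpow_le_rpow_of_exponent_le (by linarith) (by norm_num)
      have h3 : (N:ℝ)⁻¹ / 2 ≤ (N:ℝ) ^ (-(1/4) : ℝ) / Real.sqrt 2 := by
        apply div_le_div₀ (by positivity) h2 (by positivity)
        rw [Real.sqrt_le_left (by norm_num)]; norm_num
      calc (1:ℝ) / 2 = (N:ℝ)⁻¹ / 2 * N := by field_simp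
        _ ≤ σ ^ ((1:ℝ)/2) * N := mul_le_mul_of_nonneg_right (h3.trans (hσ.trans h1)) hNp.le
  calc δ ^ 2 / 8 = δ ^ 2 / 4 * (1 / 2) := by ring
    _ ≤ δ ^ 2 / 4 * (c ^ 2 * ((σ ^ ((1:ℝ)/2) * N) * L)) := by
        apply mul_le_mul_of_nonneg_left _ (by positivity)
        have h1 : (1:ℝ) / 2 ≤ (σ ^ ((1:ℝ)/2) * N) * L := by nlinarith
        have h2 : 1 ≤ c ^ 2 := one_le_pow₀ hc
        nlinarith
    _ = δ ^ 2 / 4 * (c ^ 2 * ((σ ^ ((1:ℝ)/4)) ^ 2 * Real.sqrt (N * L) ^ 2)) := by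
        rw [a1, a2]; ring
    _ = _ := by ring

theorem stmt6 (ξ A B : ℝ) (hξ : 0 < ξ) (hA : 1 < A) (hAB : B - A = 1) :
    ∃ (c C : ℝ) (N₀ : ℕ), 1 ≤ c ∧ 0 < C ∧
      ∀ s : ℕ → ℕ, StrictMono s → (∀ n, 1 ≤ n → 1 ≤ s n) →
      ∀ f : ℝ → ℝ, (∀ x : ℝ, f (x + 1) = f x) → (∫ x in (0:ℝ)..1, f x) = 0 →
        eVariationOn f (Set.Icc (0:ℝ) 1) ≤ 2 →
      ∀ M N : ℕ, N₀ ≤ N →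
        (N : ℝ) ^ (-(1/4) : ℝ) / Real.sqrt 2 ≤ fnorm A B f →
      ∀ δ : ℝ, 0 < δ →
        (volume {x ∈ Set.Icc A B |
            δ * c * fnorm A B f ^ ((1:ℝ)/4) * Real.sqrt (N * plog (plog N)) ≤
              |∑ n ∈ Finset.Icc (M + 1) (M + N), f (ξ * x ^ s n)|}).toReal ≤
          C * (Real.exp ((1 - δ / 2) * fnorm A B f ^ (-(1/2) : ℝ) * plog (plog N))
              + δ ^ (-2 : ℤ) * (N : ℝ) ^ (-16 : ℤ)) := by
  have hA' : A⁻¹ < 1 := inv_lt_one_of_one_lt₀ hA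
  have hρ : 0 < (1 - A⁻¹)⁻¹ := inv_pos.2 (by linarith)
  set K := 74 + 108 * (1 - A⁻¹)⁻¹ with hK
  have hK1 : 1 ≤ K := by rw [hK]; linarith
  obtain ⟨N₀, hN₀⟩ := params hξ hA hK1 hρ.le
  have hξ6 : 0 < 1 + 6 / ξ := by positivity
  refine ⟨K, 2 * Real.exp 1 + 256 * (1 + 6 / ξ), N₀, hK1, by positivity, ?_⟩
  intro s hs hs1 f hp h0 hv M N hN hσ δ hδ
  obtain ⟨hN2, hpar⟩ := hN₀ N hN
  have hNr : (2:ℝ) ≤ N := by exact_mod_cast hN2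
  have hNp : (0:ℝ) < N := by linarith
  have hσ0 : 0 < fnorm A B f := lt_of_lt_of_le (by positivity) hσ
  obtain ⟨hm, hS⟩ := bv_meas (bv_loc hp hv)
  have hbd := bv_bd hp h0 hv
  obtain ⟨hσ2, hl1⟩ := fnorm_facts hAB hm hp hbd hσ0
  set σ := fnorm A B f with hσdef
  set L := plog (plog N) with hL
  have hL1 : 1 ≤ L := plog_one _
  have H : Pre f σ := ⟨hm, hp, h0, hbd, hl1, fun u hu hu1 => bv_modu hp hv hbd hu hu1⟩
  obtain ⟨h, hh, c1, c2⟩ := hpar σ hσ2 hσ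
  have hu : 0 < ((N:ℝ) ^ 18)⁻¹ := by positivity
  have hu1 : ((N:ℝ) ^ 18)⁻¹ ≤ 1 := inv_le_one_of_one_le₀ (one_le_pow₀ (by linarith))
  obtain ⟨g, g', G, hg⟩ := smooth H hu hu1
  set T := δ * K * σ ^ ((1:ℝ)/4) * Real.sqrt (N * L) / 2 with hT
  have hT0 : 0 < T := by positivity
  have t1 := tail_R hξ hA hAB H hS G hg hT0 s M N hs1
  have t2 := tail_g (T := T) G hξ hA hAB (by positivity) hh c1 hσ0.le c2 s hs M N
  set S1 := {x ∈ Set.Icc A B | T ≤ |∑ n ∈ Finset.Icc (M + 1) (M + N),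
      (f (ξ * x ^ s n) - g (ξ * x ^ s n))|}
  set S2 := {x ∈ Set.Icc A B | T ≤ |∑ n ∈ Finset.Icc (M + 1) (M + N), g (ξ * x ^ s n)|}
  have f1 : volume S1 ≠ ⊤ := measure_ne_top_of_subset (fun x hx => hx.1 : S1 ⊆ Set.Icc A B) (by simp)
  have f2 : volume S2 ≠ ⊤ := measure_ne_top_of_subset (fun x hx => hx.1 : S2 ⊆ Set.Icc A B) (by simp)
  have h3 : {x ∈ Set.Icc A B | δ * K * σ ^ ((1:ℝ)/4) * Real.sqrt (N * L) ≤
      |∑ n ∈ Finset.Icc (M + 1) (M + N), f (ξ * x ^ s n)|} ⊆ S1 ∪ S2 := by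
    rintro x ⟨hx, hx2⟩
    by_contra hcon
    rw [Set.mem_union, not_or] at hcon
    have n1 : |∑ n ∈ Finset.Icc (M + 1) (M + N), (f (ξ * x ^ s n) - g (ξ * x ^ s n))| < T := by
      by_contra hc
      exact hcon.1 ⟨hx, not_lt.1 hc⟩
    have n2 : |∑ n ∈ Finset.Icc (M + 1) (M + N), g (ξ * x ^ s n)| < T := by
      by_contra hc
      exact hcon.2 ⟨hx, not_lt.1 hc⟩
    rw [Finset.sum_sub_distrib] at n1
    have n3 := abs_sub_abs_le_abs_sub (∑ n ∈ Finset.Icc (M + 1) (M + N), f (ξ * x ^ s n))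
      (∑ n ∈ Finset.Icc (M + 1) (M + N), g (ξ * x ^ s n))
    linarith
  have t3 : (volume {x ∈ Set.Icc A B | δ * K * σ ^ ((1:ℝ)/4) * Real.sqrt (N * L) ≤
      |∑ n ∈ Finset.Icc (M + 1) (M + N), f (ξ * x ^ s n)|}).toReal ≤
      (volume S1).toReal + (volume S2).toReal := by
    rw [← ENNReal.toReal_add f1 f2]
    exact ENNReal.toReal_mono (ENNReal.add_ne_top.2 ⟨f1, f2⟩)
          ((measure_mono h3).trans (measure_union_le _ _))
  have hKsq : K ≤ K ^ 2 := by nlinarith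
  have r2 : (volume S2).toReal ≤
      2 * Real.exp 1 * Real.exp ((1 - δ / 2) * σ ^ (-(1/2) : ℝ) * L) := by
    refine t2.trans ?_
    rw [mul_assoc 2 (Real.exp 1), ← Real.exp_add]
    apply mul_le_mul_of_nonneg_left _ (by norm_num)
    exact Real.exp_le_exp.2 (alg1 hσ0 hL1 hNp (by linarith) hKsq)
  have r1 : (volume S1).toReal ≤ 256 * (1 + 6 / ξ) * (δ ^ (-2 : ℤ) * (N : ℝ) ^ (-16 : ℤ)) := by
    refine t1.trans ?_
    have hTsq := alg2 hN2 hσ hL1 hK1 hδ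
    rw [← hT] at hTsq
    have z1 : δ ^ (-2 : ℤ) = (δ ^ 2)⁻¹ := by rw [zpow_neg]; norm_cast
    have z2 : (N : ℝ) ^ (-16 : ℤ) = ((N:ℝ) ^ 16)⁻¹ := by rw [zpow_neg]; norm_cast
    have z3 : (N:ℝ) * N * ((N:ℝ) ^ 18)⁻¹ = ((N:ℝ) ^ 16)⁻¹ := by
      rw [show (N:ℝ) ^ 18 = (N * N) * N ^ 16 by ring, mul_inv, ← mul_assoc,
        mul_inv_cancel₀ (by positivity), one_mul]
    rw [z1, z2]
    calc _ = 32 * (1 + 6 / ξ) * ((N:ℝ) * N * ((N:ℝ) ^ 18)⁻¹) / T ^ 2 := by ring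
      _ = 32 * (1 + 6 / ξ) * ((N:ℝ) ^ 16)⁻¹ / T ^ 2 := by rw [z3]
      _ ≤ 32 * (1 + 6 / ξ) * ((N:ℝ) ^ 16)⁻¹ / (δ ^ 2 / 8) :=
          div_le_div_of_nonneg_left (by positivity) (by positivity) hTsq
      _ = _ := by rw [div_div_eq_mul_div, div_eq_mul_inv]; ring
  refine t3.trans ((add_le_add r1 r2).trans ?_)
  have p1 : 0 < Real.exp ((1 - δ / 2) * σ ^ (-(1/2) : ℝ) * L) := Real.exp_pos _
  have p2 : 0 < δ ^ (-2 : ℤ) * (N : ℝ) ^ (-16 : ℤ) := by positivity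
  have p3 : 0 < Real.exp 1 := Real.exp_pos _
  set X := Real.exp ((1 - δ / 2) * σ ^ (-(1/2) : ℝ) * L)
  set Y := δ ^ (-2 : ℤ) * (N : ℝ) ^ (-16 : ℤ)
  have k1 : 0 ≤ 2 * Real.exp 1 * Y := by positivity
  have k2 : 0 ≤ 256 * (1 + 6 / ξ) * X := by positivity
  linarith
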